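/- arXiv:2104.10198 — 6 statements merged into one kernel-verified Lean document; each statement's English description precedes it below -/
import Mathlib

section
/- Let k be a field, V_1,…,V_d finite-dimensional k-vector spaces, and P: V_1×⋯×V_d → k a nonzero multilinear form. Then g(P) ≤ rk^S(P), i.e., the codimension of Z_P in V_2×⋯×V_d is at most the Schmidt rank of P. -/
open MvPolynomial

/-- Krull dimension of the closed subscheme of affine space cut out by an ideal of the
polynomial ring. -/
noncomputable def affineDim {σ : Type} [Fintype σ] (k : Type) [Field k]
    (I : Ideal (MvPolynomial σ k)) : WithBot ℕ∞ :=
  ringKrullDim (MvPolynomial σ k ⧸ I)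

/-- Codimension (inside the affine space of dimension `card σ`) of the closed subscheme of
affine space cut out by an ideal; the empty scheme has codimension `⊤`. -/
noncomputable def affineCodim {σ : Type} [Fintype σ] (k : Type) [Field k]
    (I : Ideal (MvPolynomial σ k)) : ℕ∞ :=
  WithBot.recBotCoe ⊤ (fun dm => (Fintype.card σ : ℕ∞) - dm) (affineDim k I)

/-- A multilinear form has Schmidt rank one if it is a product of two multilinear forms on
complementary nonempty groups of the variables. -/
def MLRankOne {k : Type} [Field k] {m : ℕ} {V : Fin m → Type} [∀ i, AddCommGroup (V i)]
    [∀ i, Module k (V i)] (P : MultilinearMap k V k) : Prop :=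
  ∃ I : Finset (Fin m), I.Nonempty ∧ I ≠ Finset.univ ∧
    ∃ (A : MultilinearMap k (fun i : {a // a ∈ I} => V i.1) k)
      (B : MultilinearMap k (fun j : {a // a ∉ I} => V j.1) k),
      ∀ v : (∀ i, V i), P v = A (fun i => v i.1) * B (fun j => v j.1)

/-- The Schmidt rank of a multilinear form: the smallest `r` such that the form is a sum of `r`
forms of Schmidt rank one. -/
noncomputable def MLSchmidtRank {k : Type} [Field k] {m : ℕ} {V : Fin m → Type}
    [∀ i, AddCommGroup (V i)] [∀ i, Module k (V i)] (P : MultilinearMap k V k) : ℕ :=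
  sInf {r | ∃ Q : Fin r → MultilinearMap k V k, (∀ i, MLRankOne (Q i)) ∧ P = ∑ i, Q i}

/-- The defining ideal of `Z_P ⊆ V_2 × ⋯ × V_d` (here `d = e + 1`, the spaces are
`V i = Fin (n i) → k` for `i : Fin (e+1)`, and `Z_P` lives in the product of the last `e` of
them): it is generated by the multilinear polynomials `(v_2, …, v_d) ↦ P(u, v_2, …, v_d)` as
`u` runs over the standard basis of `V 0`; its zero locus is exactly the set of
`(v_2, …, v_d)` with `P(v_1, v_2, …, v_d) = 0` for all `v_1`. -/
noncomputable def ZPIdeal {k : Type} [Field k] {e : ℕ} (n : Fin (e + 1) → ℕ)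
    (P : MultilinearMap k (fun i => Fin (n i) → k) k) :
    Ideal (MvPolynomial (Σ i : Fin e, Fin (n i.succ)) k) :=
  Ideal.span (Set.range fun a : Fin (n 0) =>
    ∑ j : (∀ i : Fin e, Fin (n i.succ)),
      P (Fin.cons (Pi.single a 1) fun i => Pi.single (j i) 1) •
        ∏ i : Fin e, (X ⟨i, j i⟩ : MvPolynomial (Σ i : Fin e, Fin (n i.succ)) k))

namespace MultilinearMap

/-- The polynomial with coefficients `c` that is linear in each group of arguments `Y i`, where `i`
runs over the indices satisfying `p`. -/
noncomputable def blockForm {k S : Type} [Field k] [CommRing S] [Algebra k S] {m : ℕ}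
    {n : Fin m → ℕ} (p : Fin m → Prop) [DecidablePred p] (c : (∀ i : {i // p i}, Fin (n i.1)) → k)
    (Y : ∀ i, Fin (n i) → S) : S :=
  ∑ j : (∀ i : {i // p i}, Fin (n i.1)), algebraMap k S (c j) * ∏ i : {i // p i}, Y i.1 (j i)

theorem blockForm_mul_blockForm_not {k S : Type} [Field k] [CommRing S] [Algebra k S] {m : ℕ}
    {n : Fin m → ℕ} (p : Fin m → Prop) [DecidablePred p]
    (c : (∀ i : {i // p i}, Fin (n i.1)) → k) (d : (∀ i : {i // ¬ p i}, Fin (n i.1)) → k)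
    (Y : ∀ i, Fin (n i) → S) :
    blockForm p c Y * blockForm (fun i => ¬ p i) d Y =
      ∑ j : (∀ i, Fin (n i)),
        algebraMap k S (c (fun i => j i.1) * d (fun i => j i.1)) * ∏ i, Y i (j i) := by
  rw [blockForm, blockForm, Fintype.sum_mul_sum, ← Fintype.sum_prod_type',
    ← Equiv.sum_comp (Equiv.piEquivPiSubtypeProd p fun i => Fin (n i))]
  refine Finset.sum_congr rfl fun j _ => ?_
  rw [← Fintype.prod_subtype_mul_prod_subtype p fun i => Y i (j i), map_mul]
  simp only [Equiv.piEquivPiSubtypeProd_apply]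
  ring

/-- The coordinates of the point `(u, v_2, …, v_d)`, with `v_2, …, v_d` generic. -/
noncomputable def genericPoint {k : Type} [Field k] {e : ℕ} (n : Fin (e + 1) → ℕ)
    (u : Fin (n 0) → MvPolynomial (Σ i : Fin e, Fin (n i.succ)) k) :
    ∀ i, Fin (n i) → MvPolynomial (Σ i : Fin e, Fin (n i.succ)) k :=
  Fin.cons (α := fun i => Fin (n i) → MvPolynomial (Σ i : Fin e, Fin (n i.succ)) k) u
    fun i b => X ⟨i, b⟩

theorem genericPoint_of_ne_zero {k : Type} [Field k] {e : ℕ} (n : Fin (e + 1) → ℕ)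
    (u u' : Fin (n 0) → MvPolynomial (Σ i : Fin e, Fin (n i.succ)) k) {i : Fin (e + 1)}
    (hi : i ≠ 0) : genericPoint n u i = genericPoint n u' i := by
  obtain ⟨i, rfl⟩ := Fin.exists_succ_eq.mpr hi
  rfl

theorem constantCoeff_genericPoint {k : Type} [Field k] {e : ℕ} (n : Fin (e + 1) → ℕ)
    (u : Fin (n 0) → MvPolynomial (Σ i : Fin e, Fin (n i.succ)) k) {i : Fin (e + 1)}
    (hi : i ≠ 0) (b : Fin (n i)) : constantCoeff (genericPoint n u i b) = 0 := by
  obtain ⟨i, rfl⟩ := Fin.exists_succ_eq.mpr hi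
  simp [genericPoint]

theorem blockForm_genericPoint_congr {k : Type} [Field k] {e : ℕ} {n : Fin (e + 1) → ℕ}
    (p : Fin (e + 1) → Prop) [DecidablePred p] (hp : ¬ p 0)
    (c : (∀ i : {i // p i}, Fin (n i.1)) → k)
    (u u' : Fin (n 0) → MvPolynomial (Σ i : Fin e, Fin (n i.succ)) k) :
    blockForm p c (genericPoint n u) = blockForm p c (genericPoint n u') := by
  have h (i : {i // p i}) : genericPoint n u i.1 = genericPoint n u' i.1 :=
    genericPoint_of_ne_zero n u u' fun h => hp (h ▸ i.2)
  simp only [blockForm, h]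

theorem constantCoeff_blockForm_genericPoint {k : Type} [Field k] {e : ℕ} {n : Fin (e + 1) → ℕ}
    (p : Fin (e + 1) → Prop) [DecidablePred p] (hp : ¬ p 0) (hp' : ∃ i, p i)
    (c : (∀ i : {i // p i}, Fin (n i.1)) → k)
    (u : Fin (n 0) → MvPolynomial (Σ i : Fin e, Fin (n i.succ)) k) :
    constantCoeff (blockForm p c (genericPoint n u)) = 0 := by
  obtain ⟨i, hi⟩ := hp'
  rw [blockForm, _root_.map_sum]
  refine Finset.sum_eq_zero fun j _ => ?_
  rw [map_mul, map_prod, Finset.prod_eq_zero (Finset.mem_univ (⟨i, hi⟩ : {i // p i})), mul_zero]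
  exact constantCoeff_genericPoint n u (fun h => hp (h ▸ hi)) _

/-- The polynomial `(v_2, …, v_d) ↦ P(e_a, v_2, …, v_d)`. -/
noncomputable def slicePoly {k : Type} [Field k] {e : ℕ} (n : Fin (e + 1) → ℕ) (a : Fin (n 0))
    (P : MultilinearMap k (fun i => Fin (n i) → k) k) :
    MvPolynomial (Σ i : Fin e, Fin (n i.succ)) k :=
  ∑ j : (∀ i : Fin e, Fin (n i.succ)),
    P (Fin.cons (Pi.single a 1) fun i => Pi.single (j i) 1) •
      ∏ i : Fin e, (X ⟨i, j i⟩ : MvPolynomial (Σ i : Fin e, Fin (n i.succ)) k)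

theorem slicePoly_sum {k : Type} [Field k] {e : ℕ} (n : Fin (e + 1) → ℕ) (a : Fin (n 0))
    {r : ℕ} (Q : Fin r → MultilinearMap k (fun i => Fin (n i) → k) k) :
    slicePoly n a (∑ i, Q i) = ∑ i, slicePoly n a (Q i) := by
  simp only [slicePoly, _root_.sum_apply, Finset.sum_smul]
  exact Finset.sum_comm

theorem slicePoly_eq_sum_genericPoint {k : Type} [Field k] {e : ℕ} (n : Fin (e + 1) → ℕ)
    (a : Fin (n 0)) (P : MultilinearMap k (fun i => Fin (n i) → k) k) :
    slicePoly n a P = ∑ j : (∀ i, Fin (n i)),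
      algebraMap k _ (P fun i => Pi.single (j i) 1) *
        ∏ i, genericPoint n (Pi.single a 1) i (j i) := by
  rw [← Equiv.sum_comp (Fin.consEquiv fun i => Fin (n i)), Fintype.sum_prod_type,
    Finset.sum_eq_single a]
  · refine Finset.sum_congr rfl fun j _ => ?_
    rw [Algebra.smul_def, Fin.prod_univ_succ]
    simp only [Fin.consEquiv_apply, genericPoint, Fin.cons_zero, Fin.cons_succ, Pi.single_eq_same,
      one_mul]
    congr 3
    ext i : 1
    cases i using Fin.cases <;> rfl
  · intro b _ hb
    refine Finset.sum_eq_zero fun j _ => ?_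
    rw [Fin.prod_univ_succ]
    simp [genericPoint, Pi.single_eq_of_ne hb]
  · simp

end MultilinearMap

open MultilinearMap in
theorem MLRankOne.exists_dvd_slicePoly {k : Type} [Field k] {e : ℕ} {n : Fin (e + 1) → ℕ}
    {P : MultilinearMap k (fun i => Fin (n i) → k) k} (hP : MLRankOne P) :
    ∃ F : MvPolynomial (Σ i : Fin e, Fin (n i.succ)) k,
      constantCoeff F = 0 ∧ ∀ a, F ∣ slicePoly n a P := by
  classical
  obtain ⟨I, hI, hI', A, B, hAB⟩ := hP
  let c (j : ∀ i : {i // i ∈ I}, Fin (n i.1)) : k := A fun i => Pi.single (j i) 1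
  let d (j : ∀ i : {i // i ∉ I}, Fin (n i.1)) : k := B fun i => Pi.single (j i) 1
  have key (a : Fin (n 0)) : slicePoly n a P =
      blockForm (· ∈ I) c (genericPoint n (Pi.single a 1)) *
        blockForm (· ∉ I) d (genericPoint n (Pi.single a 1)) := by
    rw [slicePoly_eq_sum_genericPoint, blockForm_mul_blockForm_not]
    simp only [hAB, c, d]
  by_cases h0 : (0 : Fin (e + 1)) ∈ I
  · refine ⟨blockForm (· ∉ I) d (genericPoint n 0),
      constantCoeff_blockForm_genericPoint _ (not_not.mpr h0) ?_ _ _, fun a => ?_⟩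
    · by_contra! h
      exact hI' (Finset.eq_univ_iff_forall.mpr h)
    · rw [key, blockForm_genericPoint_congr _ (not_not.mpr h0) d 0 (Pi.single a 1)]
      exact dvd_mul_left _ _
  · refine ⟨blockForm (· ∈ I) c (genericPoint n 0),
      constantCoeff_blockForm_genericPoint _ h0 hI _ _, fun a => ?_⟩
    rw [key, blockForm_genericPoint_congr _ h0 c 0 (Pi.single a 1)]
    exact dvd_mul_right _ _

/-- The `a`-th coordinate of the first argument, as a multilinear form in that argument. -/
def MultilinearMap.coordinate {k : Type} [Field k] {e : ℕ} {n : Fin (e + 1) → ℕ} (a : Fin (n 0)) :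
    MultilinearMap k (fun i : {i // i ∈ ({0} : Finset (Fin (e + 1)))} => Fin (n i.1) → k) k where
  toFun x := x ⟨0, Finset.mem_singleton_self 0⟩ a
  map_update_add' := by
    rintro _ x ⟨i, hi⟩ u v
    obtain rfl := Finset.mem_singleton.mp hi
    simp
  map_update_smul' := by
    rintro _ x ⟨i, hi⟩ u v
    obtain rfl := Finset.mem_singleton.mp hi
    simp

/-- Expanding along the first argument writes a multilinear form as a sum of forms of Schmidt rank
one. -/
theorem exists_eq_sum_mlRankOne {k : Type} [Field k] {e : ℕ} (he : 1 ≤ e) (n : Fin (e + 1) → ℕ)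
    (P : MultilinearMap k (fun i => Fin (n i) → k) k) :
    ∃ Q : Fin (n 0) → MultilinearMap k (fun i => Fin (n i) → k) k,
      (∀ i, MLRankOne (Q i)) ∧ P = ∑ i, Q i := by
  classical
  let L (a : Fin (n 0)) : ∀ i, (Fin (n i) → k) →ₗ[k] (Fin (n i) → k) :=
    Function.update (fun _ => LinearMap.id) 0
      (LinearMap.single k (fun _ : Fin (n 0) => k) a ∘ₗ LinearMap.proj a)
  let Q (a : Fin (n 0)) : MultilinearMap k (fun i => Fin (n i) → k) k := P.compLinearMap (L a)
  have hL (a : Fin (n 0)) (v : ∀ i, Fin (n i) → k) :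
      (fun i => L a i (v i)) = Function.update v 0 (Pi.single a (v 0 a)) := by
    ext i : 1
    obtain rfl | h := eq_or_ne i 0
    · simp [L]
    · simp [L, h]
  have hQ (a : Fin (n 0)) (v : ∀ i, Fin (n i) → k) :
      Q a v = v 0 a * P (Function.update v 0 (Pi.single a 1)) := by
    rw [← smul_eq_mul, ← P.map_update_smul, MultilinearMap.compLinearMap_apply, hL,
      ← Pi.single_smul, smul_eq_mul, mul_one]
  refine ⟨Q, fun a => ⟨{0}, Finset.singleton_nonempty 0, ?_, ?_⟩, ?_⟩
  · intro h
    have := congrArg Finset.card h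
    simp at this
    omega
  · refine ⟨MultilinearMap.coordinate a,
      P.domDomRestrict (· ∉ ({0} : Finset (Fin (e + 1)))) fun i =>
        Function.update (0 : ∀ i, Fin (n i) → k) 0 (Pi.single a 1) i.1, fun v => ?_⟩
    rw [hQ, MultilinearMap.domDomRestrict_apply]
    congr 2
    ext i : 1
    obtain rfl | h := eq_or_ne i 0
    · simp
    · simp [h]
  · refine MultilinearMap.ext fun v => ?_
    rw [sum_apply]
    simp only [Q, MultilinearMap.compLinearMap_apply, hL]
    rw [← P.map_update_sum, Finset.univ_sum_single, Function.update_eq_self]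

/-- The origin of affine space has height at least the number of variables. -/
theorem MvPolynomial.card_le_height_ker_constantCoeff {σ k : Type} [Fintype σ] [Field k] :
    (Fintype.card σ : ℕ∞) ≤ (RingHom.ker (constantCoeff : MvPolynomial σ k →+* k)).height := by
  classical
  let f (s : Finset σ) : MvPolynomial σ k →ₐ[k] MvPolynomial σ k :=
    aeval fun i => if i ∈ s then 0 else X i
  have hprime (s : Finset σ) : (RingHom.ker (f s)).IsPrime := RingHom.ker_isPrime _
  have hle (s : Finset σ) : (s.card : ℕ∞) ≤ (RingHom.ker (f s)).height := by
    induction s using Finset.induction_on with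
    | empty => simp
    | insert a s ha ih =>
      rw [Finset.card_insert_of_notMem ha, Nat.cast_add, Nat.cast_one]
      refine (add_le_add_left ih 1).trans (Ideal.height_add_one_le_of_lt_of_isPrime ?_)
      have hcomp : f (insert a s) = (f (insert a s)).comp (f s) := by
        ext i : 1
        by_cases h : i ∈ s <;> simp [f, h]
      refine SetLike.lt_iff_le_and_exists.mpr ⟨fun x hx => ?_, X a, ?_, ?_⟩
      · rw [RingHom.mem_ker] at hx ⊢
        rw [hcomp, AlgHom.comp_apply, hx, map_zero]
      · simp [f]
      · simp [f, ha]
  refine (hle Finset.univ).trans (Ideal.height_mono fun x hx => ?_)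
  have hf : f Finset.univ = aeval fun _ => 0 := by simp [f]
  rw [RingHom.mem_ker, hf, aeval_zero', algebraMap_eq] at hx
  exact (map_eq_zero_iff _ (C_injective σ k)).mp hx

/-- For a nonzero multilinear form `P : V_1 × ⋯ × V_d → k` (`d = e + 1 ≥ 2`,
`V i = Fin (n i) → k` finite dimensional), the codimension `g(P)` of `Z_P` in
`V_2 × ⋯ × V_d` is at most the Schmidt rank of `P`. -/
theorem geometric_rank_le_schmidtRank {k : Type} [Field k] {e : ℕ} (he : 1 ≤ e)
    (n : Fin (e + 1) → ℕ) (P : MultilinearMap k (fun i => Fin (n i) → k) k) (hP : P ≠ 0) :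
    affineCodim k (ZPIdeal n P) ≤ (MLSchmidtRank P : ℕ∞) := by
  obtain ⟨Q, hQ, hPQ⟩ : MLSchmidtRank P ∈ {r | ∃ Q : Fin r → MultilinearMap k
      (fun i => Fin (n i) → k) k, (∀ i, MLRankOne (Q i)) ∧ P = ∑ i, Q i} :=
    Nat.sInf_mem ⟨n 0, exists_eq_sum_mlRankOne he n P⟩
  choose F hF0 hF using fun i => (hQ i).exists_dvd_slicePoly
  have hI : ZPIdeal n P ≤ Ideal.span (Set.range F) := by
    refine Ideal.span_le.mpr ?_
    rintro _ ⟨a, rfl⟩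
    change MultilinearMap.slicePoly n a P ∈ _
    have hsum := (congrArg (MultilinearMap.slicePoly n a) hPQ).trans
      (MultilinearMap.slicePoly_sum n a Q)
    rw [hsum]
    exact Ideal.sum_mem _ fun i _ =>
      Ideal.mem_of_dvd _ (hF i a) (Ideal.subset_span (Set.mem_range_self i))
  have hdim := ringKrullDim_le_of_surjective (Ideal.Quotient.factor hI)
    (Ideal.Quotient.factor_surjective hI)
  have hprime : (RingHom.ker (constantCoeff :
      MvPolynomial (Σ i : Fin e, Fin (n i.succ)) k →+* k)).IsPrime := RingHom.ker_isPrime _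
  have hheight := Ideal.height_le_ringKrullDim_quotient_add_encard
    (p := RingHom.ker (constantCoeff : MvPolynomial (Σ i : Fin e, Fin (n i.succ)) k →+* k))
    (Set.range F) (by rintro _ ⟨i, rfl⟩; exact hF0 i)
  have hcard : (Set.range F).encard ≤ (MLSchmidtRank P : ℕ∞) := by
    rw [← Set.image_univ]
    refine (Set.encard_image_le _ _).trans ?_
    simp
  have hmain : ((Fintype.card (Σ i : Fin e, Fin (n i.succ)) : ℕ∞) : WithBot ℕ∞) ≤
      affineDim k (ZPIdeal n P) + ((MLSchmidtRank P : ℕ∞) : WithBot ℕ∞) :=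
    (WithBot.coe_le_coe.mpr card_le_height_ker_constantCoeff).trans
      (hheight.trans (add_le_add hdim (WithBot.coe_le_coe.mpr hcard)))
  rw [affineCodim]
  generalize affineDim k (ZPIdeal n P) = D at hmain
  induction D using WithBot.recBotCoe with
  | bot => exact absurd (le_bot_iff.mp hmain) WithBot.coe_ne_bot
  | coe dm => exact tsub_le_iff_left.mpr (WithBot.coe_le_coe.mp hmain)
end

section
/- Let k be a field, V a finite-dimensional k-vector space, and f a nonzero homogeneous polynomial of degree d on V. Then g_sym(f) ≤ 4·rk^S(f), i.e., the codimension of Z^sym_f in V×V is at most four times the Schmidt rank of f. -/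
open MvPolynomial

/-- The Schmidt rank (strength) of a polynomial: the smallest `r` such that
`f = ∑ i : Fin r, g i * h i` with all `g i`, `h i` homogeneous of positive degree. -/
noncomputable def polySchmidtRank {k : Type} [Field k] {σ : Type} (f : MvPolynomial σ k) : ℕ :=
  sInf {r | ∃ g h : Fin r → MvPolynomial σ k,
    (∀ i, ∃ a, 0 < a ∧ (g i).IsHomogeneous a) ∧
    (∀ i, ∃ b, 0 < b ∧ (h i).IsHomogeneous b) ∧
    f = ∑ i, g i * h i}

/-- The ideal of `Z^sym_f ⊆ V × V`: in the coordinates `(v, x)` (with `v` the `Sum.inl`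
variables and `x` the `Sum.inr` variables) it is generated, for `i : Fin n`, by
`∑ j, v j * (∂_i ∂_j f)(x)`, i.e. its zero locus is `{(v, x) | v ∈ ker H_f(x)}` where `H_f`
is the Hessian form of `f`. -/
noncomputable def zSymIdeal {k : Type} [Field k] {n : ℕ} (f : MvPolynomial (Fin n) k) :
    Ideal (MvPolynomial (Fin n ⊕ Fin n) k) :=
  Ideal.span (Set.range fun i : Fin n =>
    ∑ j : Fin n, X (Sum.inl j) * rename Sum.inr (pderiv i (pderiv j f)))

/-- The ideal of the coordinate subspace where all coordinates in `s` vanish. -/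
noncomputable def coordSubspaceIdeal {σ : Type} (k : Type) [Field k] (s : Set σ) :
    Ideal (MvPolynomial σ k) :=
  RingHom.ker (aeval (sᶜ.indicator X) : MvPolynomial σ k →ₐ[k] MvPolynomial σ k)

instance coordSubspaceIdeal_isPrime {σ k : Type} [Field k] (s : Set σ) :
    (coordSubspaceIdeal k s).IsPrime :=
  RingHom.ker_isPrime _

theorem X_mem_coordSubspaceIdeal {σ k : Type} [Field k] {s : Set σ} {a : σ} :
    (X a : MvPolynomial σ k) ∈ coordSubspaceIdeal k s ↔ a ∈ s := by
  simp [coordSubspaceIdeal, RingHom.mem_ker, X_ne_zero]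

theorem coordSubspaceIdeal_mono {σ k : Type} [Field k] {s t : Set σ} (hst : s ⊆ t) :
    coordSubspaceIdeal k s ≤ coordSubspaceIdeal k t := by
  intro p hp
  have hcomp : (aeval (tᶜ.indicator X) : MvPolynomial σ k →ₐ[k] MvPolynomial σ k).comp
      (aeval (sᶜ.indicator X)) = aeval (tᶜ.indicator X) :=
    algHom_ext fun i => by
      by_cases hi : i ∈ s
      · simp [hi, hst hi]
      · simp [hi]
  rw [coordSubspaceIdeal, RingHom.mem_ker] at hp ⊢
  rw [← hcomp, AlgHom.comp_apply, hp, map_zero]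

theorem coordSubspaceIdeal_lt_insert {σ k : Type} [Field k] {s : Set σ} {a : σ} (ha : a ∉ s) :
    coordSubspaceIdeal k s < coordSubspaceIdeal k (insert a s) :=
  lt_of_le_not_ge (coordSubspaceIdeal_mono (Set.subset_insert a s)) fun h =>
    ha (X_mem_coordSubspaceIdeal.mp (h (X_mem_coordSubspaceIdeal.mpr (Set.mem_insert a s))))

theorem card_le_height_coordSubspaceIdeal {σ k : Type} [Field k] (s : Finset σ) :
    (s.card : ℕ∞) ≤ (coordSubspaceIdeal k (s : Set σ)).height := by
  classical
  induction s using Finset.induction_on with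
  | empty => simp
  | insert a s ha ih =>
    rw [Finset.card_insert_of_notMem ha, Finset.coe_insert]
    push_cast
    exact (add_le_add_left ih 1).trans
      (Ideal.height_add_one_le_of_lt_of_isPrime (coordSubspaceIdeal_lt_insert (by simpa using ha)))

theorem mem_coordSubspaceIdeal_univ {σ k : Type} [Field k] {p : MvPolynomial σ k}
    (hp : constantCoeff p = 0) : p ∈ coordSubspaceIdeal k (Set.univ : Set σ) := by
  simp [coordSubspaceIdeal, RingHom.mem_ker, -aeval_eq_bind₁, aeval_zero', hp]

/-- If an ideal is contained in one generated by at most `r` polynomials vanishing at the origin,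
then it cuts out a scheme of codimension at most `r`. -/
theorem affineCodim_le_of_le_span {σ k : Type} [Fintype σ] [Field k]
    {I : Ideal (MvPolynomial σ k)} {s : Set (MvPolynomial σ k)}
    (hs : ∀ p ∈ s, constantCoeff p = 0) (hI : I ≤ Ideal.span s) :
    affineCodim k I ≤ s.encard := by
  have hcard := card_le_height_coordSubspaceIdeal (k := k) (Finset.univ : Finset σ)
  rw [Finset.coe_univ, Finset.card_univ] at hcard
  have hbound : ((Fintype.card σ : ℕ∞) : WithBot ℕ∞) ≤ affineDim k I + s.encard := by
    refine (WithBot.coe_le_coe.mpr hcard).trans ?_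
    refine (Ideal.height_le_ringKrullDim_quotient_add_encard s
      fun p hp => mem_coordSubspaceIdeal_univ (hs p hp)).trans ?_
    gcongr
    exact ringKrullDim_le_of_surjective _ (Ideal.Quotient.factor_surjective hI)
  unfold affineCodim
  generalize affineDim k I = D at hbound
  induction D with
  | bot => simp at hbound
  | coe m =>
    rw [WithBot.recBotCoe_coe, tsub_le_iff_left]
    exact_mod_cast hbound

theorem exists_mul_monomial {σ k : Type} [Field k] {m : σ →₀ ℕ} (hm : 2 ≤ m.degree) (c : k) :
    ∃ g h : MvPolynomial σ k, (∃ a, 0 < a ∧ g.IsHomogeneous a) ∧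
      (∃ b, 0 < b ∧ h.IsHomogeneous b) ∧ monomial m c = g * h := by
  obtain ⟨i, hi⟩ : ∃ i, m i ≠ 0 := by
    by_contra! h
    have : m = 0 := Finsupp.ext h
    simp [this] at hm
  have hle : Finsupp.single i 1 ≤ m := by
    simpa using Nat.one_le_iff_ne_zero.mpr hi
  have hm' : Finsupp.single i 1 + (m - Finsupp.single i 1) = m := add_tsub_cancel_of_le hle
  have hdeg := congrArg Finsupp.degree hm'
  rw [map_add, Finsupp.degree_single] at hdeg
  refine ⟨X i, monomial (m - Finsupp.single i 1) c, ⟨1, one_pos, isHomogeneous_X k i⟩,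
    ⟨_, ?_, isHomogeneous_monomial c rfl⟩, ?_⟩
  · lia
  · rw [X, monomial_mul, hm', one_mul]

/-- The polynomial `(v, x) ↦ ∂_v p (x)`. -/
noncomputable def dirDeriv {k : Type} [Field k] {n : ℕ} (p : MvPolynomial (Fin n) k) :
    MvPolynomial (Fin n ⊕ Fin n) k :=
  ∑ j, X (Sum.inl j) * rename Sum.inr (pderiv j p)

theorem sum_X_mul_pderiv_pderiv_mul {k : Type} [Field k] {n : ℕ}
    (g h : MvPolynomial (Fin n) k) (i : Fin n) :
    ∑ j, X (Sum.inl j) * rename (Sum.inr : Fin n → Fin n ⊕ Fin n) (pderiv i (pderiv j (g * h))) =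
      (∑ j, X (Sum.inl j) * rename Sum.inr (pderiv i (pderiv j g))) * rename Sum.inr h +
      rename Sum.inr (pderiv i h) * dirDeriv g + rename Sum.inr (pderiv i g) * dirDeriv h +
      (∑ j, X (Sum.inl j) * rename Sum.inr (pderiv i (pderiv j h))) * rename Sum.inr g := by
  simp only [dirDeriv, Finset.sum_mul, Finset.mul_sum, ← Finset.sum_add_distrib]
  refine Finset.sum_congr rfl fun j _ => ?_
  simp only [pderiv_mul, map_add, map_mul]
  ring

theorem constantCoeff_eq_zero_of_isHomogeneous {σ k : Type} [Field k] {p : MvPolynomial σ k}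
    (hp : ∃ a, 0 < a ∧ p.IsHomogeneous a) : constantCoeff p = 0 := by
  obtain ⟨a, ha, hp⟩ := hp
  exact hp.coeff_eq_zero (by simpa using ha.ne)

theorem constantCoeff_dirDeriv {k : Type} [Field k] {n : ℕ} (p : MvPolynomial (Fin n) k) :
    constantCoeff (dirDeriv p) = 0 := by
  simp [dirDeriv]

theorem affineCodim_zSymIdeal_sum_mul_le {k : Type} [Field k] {n r : ℕ}
    (g h : Fin r → MvPolynomial (Fin n) k) (hg : ∀ l, constantCoeff (g l) = 0)
    (hh : ∀ l, constantCoeff (h l) = 0) :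
    affineCodim k (zSymIdeal (∑ l, g l * h l)) ≤ 4 * (r : ℕ∞) := by
  let F : Fin 4 × Fin r → MvPolynomial (Fin n ⊕ Fin n) k := fun t =>
    ![rename Sum.inr (g t.2), rename Sum.inr (h t.2), dirDeriv (g t.2), dirDeriv (h t.2)] t.1
  refine (affineCodim_le_of_le_span (s := Set.range F) ?_ ?_).trans ?_
  · rintro _ ⟨⟨t, l⟩, rfl⟩
    fin_cases t <;> simp [F, hg, hh, constantCoeff_dirDeriv]
  · have hF (t : Fin 4) (l : Fin r) : F (t, l) ∈ Ideal.span (Set.range F) :=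
      Ideal.subset_span ⟨_, rfl⟩
    rw [zSymIdeal, Ideal.span_le]
    rintro _ ⟨i, rfl⟩
    simp only [map_sum, Finset.mul_sum]
    rw [Finset.sum_comm]
    refine Ideal.sum_mem _ fun l _ => ?_
    rw [sum_X_mul_pderiv_pderiv_mul]
    exact add_mem (add_mem (add_mem (Ideal.mul_mem_left _ _ (hF 1 l))
      (Ideal.mul_mem_left _ _ (hF 2 l))) (Ideal.mul_mem_left _ _ (hF 3 l)))
      (Ideal.mul_mem_left _ _ (hF 0 l))
  · rw [← Set.image_univ]
    refine (Set.encard_image_le _ _).trans ?_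
    simp [Set.encard_univ]

theorem zSymIdeal_eq_bot {k : Type} [Field k] {n d : ℕ} {f : MvPolynomial (Fin n) k}
    (hhom : f.IsHomogeneous d) (hd : d < 2) : zSymIdeal f = ⊥ := by
  have key (i j : Fin n) : pderiv i (pderiv j f) = 0 := by
    have h0 : (pderiv j f).IsHomogeneous 0 := by
      simpa [show d - 1 = 0 by lia] using hhom.pderiv (i := j)
    rw [totalDegree_eq_zero_iff_eq_C.mp (Nat.le_zero.mp h0.totalDegree_le), pderiv_C]
  rw [zSymIdeal, Ideal.span_eq_bot]
  rintro _ ⟨i, rfl⟩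
  simp [key]

theorem exists_sum_mul_of_isHomogeneous {σ k : Type} [Field k] {d : ℕ} {f : MvPolynomial σ k}
    (hhom : f.IsHomogeneous d) (hd : 2 ≤ d) :
    ∃ r, ∃ g h : Fin r → MvPolynomial σ k,
      (∀ i, ∃ a, 0 < a ∧ (g i).IsHomogeneous a) ∧
      (∀ i, ∃ b, 0 < b ∧ (h i).IsHomogeneous b) ∧
      f = ∑ i, g i * h i := by
  have hm (m : f.support) : 2 ≤ m.1.degree := by
    rw [Finsupp.degree_eq_weight_one]
    exact hd.trans_eq (hhom (mem_support_iff.mp m.2)).symm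
  choose g h hg hh hgh using fun m : f.support => exists_mul_monomial (hm m) (coeff m.1 f)
  let e := f.support.equivFin.symm
  refine ⟨_, g ∘ e, h ∘ e, fun i => hg _, fun i => hh _, ?_⟩
  conv_lhs => rw [f.as_sum, ← Finset.sum_coe_sort]
  simp only [Function.comp_apply, hgh]
  exact (e.sum_comp fun m => g m * h m).symm

/-- For a nonzero homogeneous polynomial `f` of degree `d` on a finite
dimensional `k`-vector space `V`, one has `g_sym(f) ≤ 4 · rk^S(f)`: the codimension of
`Z^sym_f` in `V × V` is at most four times the Schmidt rank of `f`. -/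
theorem gsym_le_four_mul_schmidtRank {k : Type} [Field k] {n d : ℕ}
    (f : MvPolynomial (Fin n) k) (hf : f ≠ 0) (hhom : f.IsHomogeneous d) :
    affineCodim k (zSymIdeal f) ≤ 4 * (polySchmidtRank f : ℕ∞) := by
  rcases lt_or_ge d 2 with hd | hd
  · rw [zSymIdeal_eq_bot hhom hd]
    exact (affineCodim_le_of_le_span (s := ∅) (by simp) bot_le).trans (by simp)
  · obtain ⟨g, h, hg, hh, hsum⟩ := Nat.sInf_mem (exists_sum_mul_of_isHomogeneous hhom hd)
    refine (congrArg (fun p => affineCodim k (zSymIdeal p)) hsum).trans_le ?_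
    exact affineCodim_zSymIdeal_sum_mul_le g h
      (fun l => constantCoeff_eq_zero_of_isHomogeneous (hg l))
      (fun l => constantCoeff_eq_zero_of_isHomogeneous (hh l))
end

section
/- Let k be a field, V_1,…,V_d finite-dimensional k-vector spaces, P: V_1×⋯×V_d → k a multilinear form, V'_1 ⊂ V_1 a subspace of codimension c, and ℓ_1,…,ℓ_c a basis of the annihilator of V'_1 in V_1^*. Suppose there are multilinear forms P_{I_s} on V_1 × ∏_{a∈I_s} V_a (s=1,…,r) and Q_{J_t} on ∏_{b∈J_t} V_b (t=1,…,p), for subsets I_1,…,I_r, J_1,…,J_p ⊂ [2,d], such that the restriction of P to V'_1×V_2×⋯×V_d belongs to the tensor ideal generated by the restrictions of the P_{I_s} to V'_1 and by the Q_{J_t}. Then P belongs to the tensor ideal generated by ℓ_1,…,ℓ_c, the P_{I_s}, and the Q_{J_t}. In particular, rk^S(P) ≤ rk^S(P restricted to V'_1×V_2×⋯×V_d) + c. -/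
/-- Linearly independent functionals on a finite-dimensional space admit a dual family of
vectors. -/
theorem LinearIndependent.exists_dual_family {k W ι : Type*} [Field k] [AddCommGroup W]
    [Module k W] [FiniteDimensional k W] [DecidableEq ι] {ℓ : ι → (W →ₗ[k] k)}
    (hℓ : LinearIndependent k ℓ) :
    ∃ u : ι → W, ∀ a b, ℓ a (u b) = if a = b then 1 else 0 := by
  obtain ⟨g, hg⟩ := (Finsupp.linearCombination k ℓ).exists_leftInverse_of_injective
    (LinearMap.ker_eq_bot.mpr hℓ)
  refine ⟨fun b => (Module.evalEquiv k W).symm (Finsupp.lapply b ∘ₗ g), fun a b => ?_⟩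
  have h : g (ℓ a) = Finsupp.single a 1 := by
    simpa using LinearMap.congr_fun hg (Finsupp.single a 1)
  rw [Module.apply_evalEquiv_symm_apply, LinearMap.comp_apply, h, Finsupp.lapply_apply,
    Finsupp.single_apply]

theorem Function.restrict_update_of_mem {ι : Type*} [DecidableEq ι] {V : ι → Type*}
    {p : ι → Prop} (v : ∀ i, V i) {i : ι} (h : p i) (z : V i) :
    (fun j : {a // p a} => Function.update v i z j.1) =
      Function.update (fun j : {a // p a} => v j.1) ⟨i, h⟩ z :=
  Function.update_comp_eq_of_injective' v Subtype.val_injective (⟨i, h⟩ : {a // p a}) z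

theorem Function.restrict_update_of_notMem {ι : Type*} [DecidableEq ι] {V : ι → Type*}
    {p : ι → Prop} (v : ∀ i, V i) {i : ι} (h : ¬ p i) (z : V i) :
    (fun j : {a // p a} => Function.update v i z j.1) =
      fun j : {a // p a} => v j.1 :=
  Function.update_comp_eq_of_forall_ne' v z fun j hj => h (hj ▸ j.2)

namespace MultilinearMap

/-- The product of two multilinear forms on complementary groups of variables. -/
def mulCompl {k ι : Type*} [CommSemiring k] {V : ι → Type*} [∀ i, AddCommMonoid (V i)]
    [∀ i, Module k (V i)] {p : ι → Prop}
    (A : MultilinearMap k (fun i : {a // p a} => V i.1) k)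
    (B : MultilinearMap k (fun i : {a // ¬ p a} => V i.1) k) : MultilinearMap k V k where
  toFun v := A (fun i => v i.1) * B (fun i => v i.1)
  map_update_add' v i x y := by
    by_cases h : p i
    · simp only [Function.restrict_update_of_mem v h,
        Function.restrict_update_of_notMem (p := fun a => ¬ p a) v (not_not.mpr h),
        MultilinearMap.map_update_add, add_mul]
    · simp only [Function.restrict_update_of_notMem v h,
        Function.restrict_update_of_mem (p := fun a => ¬ p a) v h,
        MultilinearMap.map_update_add, mul_add]
  map_update_smul' v i c x := by
    by_cases h : p i
    · simp only [Function.restrict_update_of_mem v h,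
        Function.restrict_update_of_notMem (p := fun a => ¬ p a) v (not_not.mpr h),
        MultilinearMap.map_update_smul, smul_eq_mul, mul_assoc]
    · simp only [Function.restrict_update_of_notMem v h,
        Function.restrict_update_of_mem (p := fun a => ¬ p a) v h,
        MultilinearMap.map_update_smul, smul_eq_mul, mul_left_comm]

/-- A linear functional on one factor, as a multilinear form in the single variable of that
factor. -/
def ofSingleton {k ι : Type*} [CommSemiring k] {V : ι → Type*} [∀ i, AddCommMonoid (V i)]
    [∀ i, Module k (V i)] (i₀ : ι) (f : V i₀ →ₗ[k] k) :
    MultilinearMap k (fun i : {a // a ∈ ({i₀} : Finset ι)} => V i.1) k where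
  toFun v := f (v ⟨i₀, Finset.mem_singleton_self i₀⟩)
  map_update_add' v i x y := by
    obtain ⟨i, hi⟩ := i
    obtain rfl := Finset.mem_singleton.mp hi
    simp
  map_update_smul' v i c x := by
    obtain ⟨i, hi⟩ := i
    obtain rfl := Finset.mem_singleton.mp hi
    simp

/-- A multilinear form vanishing when its `i₀`-th argument lies in the common kernel of linearly
independent functionals lies in the tensor ideal they generate. -/
theorem exists_eq_sum_mul_of_forall_eq_zero {k ι κ : Type*} [Field k] [Fintype κ]
    {V : ι → Type*} [∀ i, AddCommGroup (V i)] [∀ i, Module k (V i)] (i₀ : ι)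
    [FiniteDimensional k (V i₀)] {ℓ : κ → (V i₀ →ₗ[k] k)} (hℓ : LinearIndependent k ℓ)
    (F : MultilinearMap k V k) (hF : ∀ v, (∀ a, ℓ a (v i₀) = 0) → F v = 0)
    {p : ι → Prop} (hp : ∀ i, p i ↔ i ≠ i₀) :
    ∃ T : κ → MultilinearMap k (fun i : {a // p a} => V i.1) k,
      ∀ v, F v = ∑ a, ℓ a (v i₀) * T a (fun i => v i.1) := by
  classical
  obtain ⟨u, hu⟩ := hℓ.exists_dual_family
  refine ⟨fun a => F.domDomRestrict p fun i => Function.update (0 : ∀ i, V i) i₀ (u a) i.1,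
    fun v => ?_⟩
  have hT (a : κ) : (F.domDomRestrict p fun i => Function.update (0 : ∀ i, V i) i₀ (u a) i.1)
      (fun i => v i.1) = F (Function.update v i₀ (u a)) := by
    rw [domDomRestrict_apply]
    congr 1
    funext j
    by_cases h : j = i₀
    · subst h
      simp [hp]
    · simp [hp, h]
  simp only [hT]
  have hz : F (Function.update v i₀ (v i₀ - ∑ a, ℓ a (v i₀) • u a)) = 0 :=
    hF _ fun b => by simp [hu]
  rw [map_update_sub, Function.update_eq_self, map_update_sum, sub_eq_zero] at hz
  simpa only [MultilinearMap.map_update_smul, smul_eq_mul] using hz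

end MultilinearMap

/-- The product of a functional on one factor and a form in the other variables has Schmidt rank
one, provided there is at least one other variable. -/
theorem MLRankOne.of_singleton_mul {k : Type} [Field k] {m : ℕ} {V : Fin m → Type}
    [∀ i, AddCommGroup (V i)] [∀ i, Module k (V i)] {i₀ : Fin m}
    (h : ({i₀} : Finset (Fin m)) ≠ Finset.univ) (f : V i₀ →ₗ[k] k)
    (T : MultilinearMap k (fun i : {a // a ∉ ({i₀} : Finset (Fin m))} => V i.1) k) :
    MLRankOne ((MultilinearMap.ofSingleton i₀ f).mulCompl T) :=
  ⟨{i₀}, Finset.singleton_nonempty i₀, h, MultilinearMap.ofSingleton i₀ f, T, fun _ => rfl⟩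

/-- With a single variable there are no forms of Schmidt rank one, so the Schmidt rank takes its
default value. -/
theorem MLSchmidtRank_eq_zero_of_singleton_eq_univ {k : Type} [Field k] {m : ℕ}
    {V : Fin m → Type} [∀ i, AddCommGroup (V i)] [∀ i, Module k (V i)] {i₀ : Fin m}
    (h : ({i₀} : Finset (Fin m)) = Finset.univ) (P : MultilinearMap k V k) :
    MLSchmidtRank P = 0 := by
  have hno (Q : MultilinearMap k V k) : ¬ MLRankOne Q := by
    rintro ⟨I, hI, hne, -⟩
    exact hne ((hI.subset_singleton_iff.mp (h ▸ Finset.subset_univ I)).trans h)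
  rw [MLSchmidtRank, Nat.sInf_eq_zero]
  by_cases hP : P = 0
  · exact Or.inl ⟨Fin.elim0, fun i => i.elim0, by simpa using hP⟩
  · refine Or.inr (Set.eq_empty_of_forall_notMem ?_)
    rintro (_ | r) ⟨Q, hQ, hsum⟩
    · exact hP (by simpa using hsum)
    · exact hno _ (hQ 0)

/-- Let `P` be a multilinear form on `V_1 × ⋯ × V_d` (`d = e + 1`, indices in
`Fin (e+1)`, the first factor having index `0`), `V' ⊆ V 0` a subspace of codimension `c`, and
`ℓ 1, …, ℓ c` a basis of the annihilator of `V'` in `(V 0)^*`. Suppose we are given multilinear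
forms `Pgen s` on `V 0 × ∏_{a ∈ I s} V a` (with `0 ∉ I s ⊆ [2,d]`) and `Qgen t` on
`∏_{b ∈ J t} V b` (with `0 ∉ J t ⊆ [2,d]` nonempty), such that the restriction of `P` to
`V' × V 1 × ⋯` lies in the tensor ideal generated by the restrictions of the `Pgen s` and by
the `Qgen t` — i.e. there are cofactor forms `Rc`, `Sc` on the complementary groups of
factors with the displayed identity for all tuples `v` with `v 0 ∈ V'`. Then `P` lies in the
tensor ideal generated by the `ℓ a`, the `Pgen s` and the `Qgen t`; in particular
`rk^S(P) ≤ rk^S(P|_{V' × V 1 × ⋯}) + c`. -/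
theorem tensor_ideal_restriction {k : Type} [Field k] {e : ℕ} {V : Fin (e + 1) → Type}
    [∀ i, AddCommGroup (V i)] [∀ i, Module k (V i)] [∀ i, FiniteDimensional k (V i)]
    (P : MultilinearMap k V k) (V' : Submodule k (V 0)) (c : ℕ)
    (ℓ : Fin c → (V 0 →ₗ[k] k)) (hℓ : LinearIndependent k ℓ)
    (hℓV' : ∀ x : V 0, x ∈ V' ↔ ∀ a, ℓ a x = 0)
    {r p : ℕ} (I : Fin r → Finset (Fin (e + 1))) (hI : ∀ s, 0 ∉ I s)
    (J : Fin p → Finset (Fin (e + 1))) (hJ : ∀ t, 0 ∉ J t) (hJne : ∀ t, (J t).Nonempty)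
    (Pgen : ∀ s, MultilinearMap k (fun i : {a // a ∈ insert 0 (I s)} => V i.1) k)
    (Qgen : ∀ t, MultilinearMap k (fun j : {a // a ∈ J t} => V j.1) k)
    (Rc : ∀ s, MultilinearMap k (fun i : {a // a ∉ insert 0 (I s)} => V i.1) k)
    (Sc : ∀ t, MultilinearMap k (fun j : {a // a ∉ J t} => V j.1) k)
    (hyp : ∀ v : (∀ i, V i), v 0 ∈ V' →
      P v = ∑ s, Pgen s (fun i => v i.1) * Rc s (fun i => v i.1)
        + ∑ t, Qgen t (fun j => v j.1) * Sc t (fun j => v j.1)) :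
    (∃ (T : Fin c → MultilinearMap k (fun i : {a : Fin (e + 1) // a ≠ 0} => V i.1) k)
      (Rc' : ∀ s, MultilinearMap k (fun i : {a // a ∉ insert 0 (I s)} => V i.1) k)
      (Sc' : ∀ t, MultilinearMap k (fun j : {a // a ∉ J t} => V j.1) k),
      ∀ v : (∀ i, V i),
        P v = ∑ a, ℓ a (v 0) * T a (fun i => v i.1)
          + ∑ s, Pgen s (fun i => v i.1) * Rc' s (fun i => v i.1)
          + ∑ t, Qgen t (fun j => v j.1) * Sc' t (fun j => v j.1)) ∧
    (∀ r' : ℕ, (∃ Q : Fin r' → MultilinearMap k V k, (∀ i, MLRankOne (Q i)) ∧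
        ∀ v : (∀ i, V i), v 0 ∈ V' → P v = ∑ i, Q i v) →
      MLSchmidtRank P ≤ r' + c) := by
  constructor
  · obtain ⟨T, hT⟩ := MultilinearMap.exists_eq_sum_mul_of_forall_eq_zero 0 hℓ
      (P - (∑ s, (Pgen s).mulCompl (Rc s) + ∑ t, (Qgen t).mulCompl (Sc t)))
      (fun v hv => by
        simp [hyp v ((hℓV' _).mpr hv), MultilinearMap.mulCompl])
      (p := fun i => i ≠ 0) fun _ => Iff.rfl
    refine ⟨T, Rc, Sc, fun v => ?_⟩
    rw [← hT v]
    simp only [sub_apply, add_apply, sum_apply,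
      MultilinearMap.mulCompl, MultilinearMap.coe_mk]
    ring
  · rintro r' ⟨Q, hQ, hPQ⟩
    by_cases h : ({0} : Finset (Fin (e + 1))) = Finset.univ
    · simp [MLSchmidtRank_eq_zero_of_singleton_eq_univ h P]
    obtain ⟨T, hT⟩ := MultilinearMap.exists_eq_sum_mul_of_forall_eq_zero 0 hℓ (P - ∑ i, Q i)
      (fun v hv => by simp [hPQ v ((hℓV' _).mpr hv)])
      (p := fun i => i ∉ ({0} : Finset (Fin (e + 1)))) fun _ => by simp
    refine Nat.sInf_le ⟨Fin.append Q fun a => (MultilinearMap.ofSingleton 0 (ℓ a)).mulCompl (T a),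
      fun i => ?_, ?_⟩
    · refine Fin.addCases (fun i => ?_) (fun i => ?_) i
      · simpa using hQ i
      · simpa using MLRankOne.of_singleton_mul h (ℓ i) (T i)
    · ext v
      have := hT v
      rw [sub_apply, sub_eq_iff_eq_add'] at this
      simpa [Fin.sum_univ_add, sum_apply, MultilinearMap.mulCompl,
        MultilinearMap.ofSingleton] using this
end

section
/- Let R be a commutative ring, M and N finite free R-modules, and f: M → N an R-linear map such that the induced map ∧^{r+1}f: ∧^{r+1}M → ∧^{r+1}N is zero. Then for all φ_1,…,φ_r ∈ N^* = Hom_R(N,R) and every α ∈ ∧^{r+1}M, the element ι_{f^∨φ_1}⋯ι_{f^∨φ_r}(α) ∈ M lies in the kernel of f, where f^∨: N^* → M^* is the dual map and ι denotes contraction (interior product) of an exterior power by a linear functional. -/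
open CliffordAlgebra in
/-- Contraction is natural with respect to the map induced on exterior algebras. -/
theorem ExteriorAlgebra.map_contractLeft_dualMap {R M N : Type*} [CommRing R]
    [AddCommGroup M] [Module R M] [AddCommGroup N] [Module R N]
    (f : M →ₗ[R] N) (φ : Module.Dual R N) (x : ExteriorAlgebra R M) :
    ExteriorAlgebra.map f (contractLeft (Q := (0 : QuadraticForm R M)) (f.dualMap φ) x) =
      contractLeft (Q := (0 : QuadraticForm R N)) φ (ExteriorAlgebra.map f x) := by
  induction x using CliffordAlgebra.left_induction with
  | algebraMap r =>
    rw [contractLeft_algebraMap, map_zero, AlgHom.commutes]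
    exact (contractLeft_algebraMap 0 φ r).symm
  | add x y hx hy => simp only [map_add, hx, hy]
  | ι_mul x m hx =>
    have hι : ExteriorAlgebra.map f (CliffordAlgebra.ι 0 m) = CliffordAlgebra.ι 0 (f m) :=
      ExteriorAlgebra.map_apply_ι f m
    rw [contractLeft_ι_mul, map_sub, map_smul, map_mul, map_mul, hx, hι]
    exact (contractLeft_ι_mul φ (f m) _).symm

open CliffordAlgebra in
/-- Contraction lowers the degree by one. -/
theorem ExteriorAlgebra.contractLeft_mem_exteriorPower {R M : Type*} [CommRing R]
    [AddCommGroup M] [Module R M] (φ : Module.Dual R M) (n : ℕ) {x : ExteriorAlgebra R M}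
    (hx : x ∈ ⋀[R]^(n + 1) M) :
    contractLeft (Q := (0 : QuadraticForm R M)) φ x ∈ ⋀[R]^n M := by
  induction n generalizing x with
  | zero =>
    rw [zero_add, exteriorPower, pow_one] at hx
    obtain ⟨m, rfl⟩ := hx
    rw [exteriorPower, pow_zero, Submodule.mem_one]
    exact ⟨φ m, (contractLeft_ι 0 φ m).symm⟩
  | succ n ih =>
    rw [exteriorPower, pow_succ'] at hx
    induction hx using Submodule.mul_induction_on' with
    | mem_mul_mem a ha b hb =>
      obtain ⟨m, rfl⟩ := ha
      have h := contractLeft_ι_mul (Q := (0 : QuadraticForm R M)) φ m b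
      refine h ▸ Submodule.sub_mem _ (Submodule.smul_mem _ _ hb) ?_
      rw [exteriorPower, pow_succ']
      exact Submodule.mul_mem_mul ⟨m, rfl⟩ (ih hb)
    | add x _ y _ hx hy => rw [map_add]; exact Submodule.add_mem _ hx hy

/-- Iterated contraction with functionals pulled back along `f` lowers the degree by the number of
functionals, and preserves being killed by `ExteriorAlgebra.map f`. -/
theorem ExteriorAlgebra.foldr_contractLeft_dualMap {R M N : Type*} [CommRing R]
    [AddCommGroup M] [Module R M] [AddCommGroup N] [Module R N]
    (f : M →ₗ[R] N) (k r : ℕ) (φ : Fin r → Module.Dual R N) {α : ExteriorAlgebra R M}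
    (hα : α ∈ ⋀[R]^(r + k) M) (hf : ExteriorAlgebra.map f α = 0) :
    let β := (List.ofFn fun i =>
      (CliffordAlgebra.contractLeft (Q := (0 : QuadraticForm R M)) (f.dualMap (φ i)) :
        ExteriorAlgebra R M →ₗ[R] ExteriorAlgebra R M)).foldr (fun g x => g x) α
    β ∈ ⋀[R]^k M ∧ ExteriorAlgebra.map f β = 0 := by
  induction r generalizing k with
  | zero => simpa using And.intro hα hf
  | succ r ih =>
    rw [add_right_comm, add_assoc] at hα
    obtain ⟨hmem, hmap⟩ := ih (k + 1) (fun i => φ i.succ) hα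
    rw [List.ofFn_succ, List.foldr_cons]
    refine ⟨contractLeft_mem_exteriorPower _ _ hmem, ?_⟩
    rw [map_contractLeft_dualMap, hmap]
    exact map_zero _

/-- Let `R` be a commutative ring, `M`, `N` finite free `R`-modules and
`f : M →ₗ[R] N` an `R`-linear map such that the induced map `⋀^{r+1} f` on `(r+1)`-st exterior
powers is zero (equivalently, the algebra map `ExteriorAlgebra.map f` kills `⋀[R]^(r+1) M`).
Then for all functionals `φ 1, …, φ r : N → R` and every `α ∈ ⋀[R]^(r+1) M`, the element
`ι_{f^∨(φ 1)} ⋯ ι_{f^∨(φ r)} (α)` — a degree-one element of the exterior algebra, i.e. an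
element of `M` — lies in the kernel of `f`.  Contraction with a functional `ψ : M → R` is
`CliffordAlgebra.contractLeft ψ` (the exterior algebra being the Clifford algebra of the zero
quadratic form), and `f^∨ : N^* → M^*` is the dual map. -/
theorem contraction_mem_ker {R M N : Type} [CommRing R]
    [AddCommGroup M] [Module R M] [AddCommGroup N] [Module R N]
    [Module.Free R M] [Module.Finite R M] [Module.Free R N] [Module.Finite R N]
    (f : M →ₗ[R] N) (r : ℕ)
    (hf : ∀ β ∈ ⋀[R]^(r + 1) M, ExteriorAlgebra.map f β = 0)
    (φ : Fin r → Module.Dual R N) (α : ExteriorAlgebra R M) (hα : α ∈ ⋀[R]^(r + 1) M) :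
    ∃ m ∈ LinearMap.ker f,
      ExteriorAlgebra.ι R m =
        (List.ofFn fun i =>
          (CliffordAlgebra.contractLeft (Q := (0 : QuadraticForm R M)) (f.dualMap (φ i)) :
            ExteriorAlgebra R M →ₗ[R] ExteriorAlgebra R M)).foldr (fun g x => g x) α := by
  obtain ⟨hmem, hmap⟩ := ExteriorAlgebra.foldr_contractLeft_dualMap f 1 r φ hα (hf α hα)
  rw [ExteriorAlgebra.exteriorPower, pow_one] at hmem
  obtain ⟨m, hm⟩ := hmem
  refine ⟨m, ?_, hm⟩
  rw [← hm, ExteriorAlgebra.map_apply_ι, ExteriorAlgebra.ι_eq_zero_iff] at hmap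
  exact hmap
end

section
/- Let k be a field, V a finite-dimensional k-vector space, X ⊂ V an irreducible closed subvariety of codimension c, and v_0 ∈ X a smooth k-point of X. Let g_1,…,g_c be elements of the ideal I_X ⊂ k[V] of X whose differentials at v_0 are linearly independent. Then for any f ∈ I_X and any n ≥ 1, the n-th derivative f^{(n)}_{v_0} ∈ k[V] belongs to the ideal of k[V] generated by the elements (g_i)^{(j)}_{v_0} for i = 1,…,c and 1 ≤ j ≤ n. -/
open MvPolynomial

/-- `taylorComp v0 m f` is the `m`-th derivative `f^{(m)}_{v0}` of `f` at `v0`: the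
degree-`m` homogeneous component (in `v`) of `f(v + v0)`. -/
noncomputable def taylorComp {k : Type} [Field k] {N : ℕ} (v0 : Fin N → k) (m : ℕ)
    (f : MvPolynomial (Fin N) k) : MvPolynomial (Fin N) k :=
  homogeneousComponent m (aeval (fun i => X i + C (v0 i)) f)

/-- The differential of a polynomial `g` at the point `v0`, as a linear functional. -/
noncomputable def diffAt {k : Type} [Field k] {N : ℕ} (v0 : Fin N → k)
    (g : MvPolynomial (Fin N) k) : (Fin N → k) →ₗ[k] k :=
  ∑ i, eval v0 (pderiv i g) • LinearMap.proj i

theorem WithBot.exists_natCast_eq_of_add_natCast_eq {D : WithBot ℕ∞} {a b : ℕ}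
    (h : D + a = (b : WithBot ℕ∞)) : ∃ e : ℕ, D = e ∧ e + a = b := by
  induction D using WithBot.recBotCoe with
  | bot => simp at h
  | coe D =>
    have h1 : D + a = (b : ℕ∞) := by exact_mod_cast h
    lift D to ℕ using fun h => by simp [h] at h1
    exact ⟨D, rfl, by exact_mod_cast h1⟩

open IsLocalRing in
theorem IsLocalRing.spanFinrank_maximalIdeal_quotient_span_add_le {R : Type*} [CommRing R]
    [IsLocalRing R] [IsNoetherianRing R] {c : ℕ} (g : Fin c → maximalIdeal R)
    (hg : LinearIndependent (ResidueField R) fun i => (maximalIdeal R).toCotangent (g i))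
    [IsLocalRing (R ⧸ Ideal.span (Set.range fun i => (g i : R)))] :
    (maximalIdeal (R ⧸ Ideal.span (Set.range fun i => (g i : R)))).spanFinrank + c ≤
      (maximalIdeal R).spanFinrank := by
  set I := Ideal.span (Set.range fun i => (g i : R)) with hI
  let b := Module.Basis.sumExtend hg
  have : Finite (Fin c ⊕ Module.Basis.sumExtendIndex hg) := Module.Finite.finite_basis b
  have : Finite (Module.Basis.sumExtendIndex hg) :=
    Finite.of_injective _ (Sum.inr_injective (α := Fin c))
  have hcard : c + Nat.card (Module.Basis.sumExtendIndex hg) =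
      (maximalIdeal R).spanFinrank := by
    rw [spanFinrank_maximalIdeal_eq_finrank_cotangentSpace,
      Module.finrank_eq_nat_card_basis b, Nat.card_sum, Nat.card_fin]
  choose y hy using fun j => (maximalIdeal R).toCotangent_surjective (b (Sum.inr j))
  have hbl : ∀ i, b (Sum.inl i) = (maximalIdeal R).toCotangent (g i) := fun i => by
    simp only [b, Module.Basis.sumExtend, Module.Basis.coe_reindex, Module.Basis.coe_extend]
    rfl
  have hspan : Submodule.span R (Set.range g ∪ Set.range y) = ⊤ := by
    rw [← CotangentSpace.span_image_eq_top_iff, eq_top_iff, ← b.span_eq]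
    refine Submodule.span_mono ?_
    rintro _ ⟨i | j, rfl⟩
    · exact ⟨g i, Or.inl ⟨i, rfl⟩, (hbl i).symm⟩
    · exact ⟨y j, Or.inr ⟨j, rfl⟩, hy j⟩
  have hmax : maximalIdeal R =
      Ideal.span (Set.range (fun i => (g i : R)) ∪ Set.range fun j => (y j : R)) := by
    have := congrArg (Submodule.map (maximalIdeal R).subtype) hspan
    rw [Submodule.map_span, Submodule.map_top, Submodule.range_subtype, Set.image_union,
      ← Set.range_comp, ← Set.range_comp] at this
    exact this.symm
  have hquot : maximalIdeal (R ⧸ I) =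
      Ideal.span (Set.range fun j => Ideal.Quotient.mk I (y j : R)) := by
    rw [← map_maximalIdeal_of_surjective _ (Ideal.Quotient.mk_surjective (I := I)),
      congrArg (Ideal.map (Ideal.Quotient.mk I)) hmax, Ideal.span_union,
      Ideal.map_sup, ← hI, Ideal.map_quotient_self, bot_sup_eq, Ideal.map_span,
      ← Set.range_comp]
    rfl
  rw [← hcard, add_comm, hquot]
  gcongr
  refine (Submodule.spanFinrank_span_le_ncard_of_finite (Set.finite_range _)).trans ?_
  exact (congrArg Set.ncard Set.image_univ.symm).le.trans <|
    (Set.ncard_image_le Set.finite_univ).trans (Set.ncard_univ _).le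

theorem Ideal.height_add_ringKrullDim_quotient_le {R : Type*} [CommRing R] (p : Ideal R)
    [hp : p.IsPrime] : p.height + ringKrullDim (R ⧸ p) ≤ ringKrullDim R := by
  let P : PrimeSpectrum R := ⟨p, hp⟩
  have hcoh : ringKrullDim (R ⧸ p) = (Order.coheight P : WithBot ℕ∞) := by
    rw [ringKrullDim_quotient, Order.coheight_eq_krullDim_Ici]
    rfl
  have : Nonempty (PrimeSpectrum R) := ⟨P⟩
  rw [hcoh, PrimeSpectrum.height_eq_orderHeight P, ringKrullDim,
    Order.krullDim_eq_iSup_height_add_coheight_of_nonempty, ← WithBot.coe_add, WithBot.coe_le_coe]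
  exact le_iSup (fun a : PrimeSpectrum R => Order.height a + Order.coheight a) P

open IsLocalRing in
theorem IsRegularLocalRing.quotient_span_of_linearIndependent {R : Type*} [CommRing R]
    [IsRegularLocalRing R] {c : ℕ} (g : Fin c → maximalIdeal R)
    (hg : LinearIndependent (ResidueField R) fun i => (maximalIdeal R).toCotangent (g i)) :
    IsRegularLocalRing (R ⧸ Ideal.span (Set.range fun i => (g i : R))) ∧
      ringKrullDim (R ⧸ Ideal.span (Set.range fun i => (g i : R))) + c = ringKrullDim R := by
  have hle : Ideal.span (Set.range fun i => (g i : R)) ≤ maximalIdeal R := by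
    rw [Ideal.span_le]
    rintro _ ⟨i, rfl⟩
    exact (g i).2
  have : Nontrivial (R ⧸ Ideal.span (Set.range fun i => (g i : R))) :=
    Ideal.Quotient.nontrivial_iff.2
      (ne_top_of_le_ne_top (Ideal.IsPrime.ne_top inferInstance) hle)
  have : IsLocalRing (R ⧸ Ideal.span (Set.range fun i => (g i : R))) :=
    .of_surjective' _ Ideal.Quotient.mk_surjective
  have h1 := spanFinrank_maximalIdeal_quotient_span_add_le g hg
  have h2 := ringKrullDim_le_spanFinrank_maximalIdeal
    (R ⧸ Ideal.span (Set.range fun i => (g i : R)))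
  have h3 := ringKrullDim_le_ringKrullDim_quotient_add_spanFinrank
    (Ideal.span (Set.range fun i => (g i : R))) (by rwa [ringJacobson_eq_maximalIdeal])
  have h4 : (Ideal.span (Set.range fun i => (g i : R))).spanFinrank ≤ c := by
    refine (Submodule.spanFinrank_span_le_ncard_of_finite (Set.finite_range _)).trans ?_
    refine (congrArg Set.ncard Set.image_univ.symm).le.trans <|
      (Set.ncard_image_le Set.finite_univ).trans ?_
    simp [Set.ncard_univ]
  have h0 := IsRegularLocalRing.spanFinrank_maximalIdeal (R := R)
  rw [← h0] at h3 ⊢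
  generalize (Ideal.span (Set.range fun i => (g i : R))).spanFinrank = s at *
  generalize (maximalIdeal R).spanFinrank = d at *
  have key :
      ((maximalIdeal (R ⧸ Ideal.span (Set.range fun i => (g i : R)))).spanFinrank : WithBot ℕ∞) ≤
      ringKrullDim (R ⧸ Ideal.span (Set.range fun i => (g i : R))) ∧
      ringKrullDim (R ⧸ Ideal.span (Set.range fun i => (g i : R))) + c = d := by
    generalize ringKrullDim (R ⧸ Ideal.span (Set.range fun i => (g i : R))) = D at *
    generalize (maximalIdeal (R ⧸ Ideal.span (Set.range fun i => (g i : R)))).spanFinrank = e at *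
    induction D using WithBot.recBotCoe with
    | bot => simp at h3
    | coe D =>
      have hD : D ≤ e := by exact_mod_cast h2
      lift D to ℕ using ne_top_of_le_ne_top (ENat.natCast_ne_top e) hD
      have h3' : d ≤ D + s := by exact_mod_cast h3
      have hD' : D ≤ e := by exact_mod_cast hD
      constructor
      · have : e ≤ D := by omega
        exact_mod_cast this
      · have : D + c = d := by omega
        exact_mod_cast this
  exact ⟨.of_spanFinrank_maximalIdeal_le _ key.1, key.2⟩

open IsLocalRing in
theorem IsRegularLocalRing.isDomain_of_ringKrullDim_eq (d : ℕ) :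
    ∀ (R : Type*) [CommRing R] [IsRegularLocalRing R], ringKrullDim R = d → IsDomain R := by
  induction d with
  | zero =>
    intro R _ _ hd
    have h0 := IsRegularLocalRing.spanFinrank_maximalIdeal (R := R)
    rw [hd, Nat.cast_inj, Submodule.spanFinrank_eq_zero_iff_eq_bot
      (IsNoetherian.noetherian _)] at h0
    exact (isField_iff_maximalIdeal_eq.2 h0).isDomain
  | succ d ih =>
    intro R _ _ hd
    have hbot : maximalIdeal R ≠ ⊥ := fun h => by
      rw [ringKrullDim_eq_zero_of_isField (isField_iff_maximalIdeal_eq.2 h)] at hd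
      exact absurd hd.symm (by exact_mod_cast d.succ_ne_zero)
    have hfin := minimalPrimes.finite_of_isNoetherianRing R
    obtain ⟨x, hxm, hx⟩ : ∃ x ∈ maximalIdeal R,
        x ∉ ⋃ I ∈ insert (maximalIdeal R ^ 2) (minimalPrimes R), (I : Set R) := by
      by_contra! h
      obtain ⟨I, hI, hle⟩ := (Ideal.subset_union_prime_finite (hfin.insert (maximalIdeal R ^ 2))
        (f := id) (maximalIdeal R ^ 2) (maximalIdeal R ^ 2)
        (fun I hI h1 _ => (Set.mem_of_mem_insert_of_ne hI h1).1.1)).1 h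
      obtain rfl | hI := hI
      · refine hbot (Submodule.eq_bot_of_le_smul_of_le_jacobson_bot (maximalIdeal R) _
          (IsNoetherian.noetherian _) ?_ (jacobson_eq_maximalIdeal _ bot_ne_top).ge)
        rwa [smul_eq_mul, ← pow_two]
      · have := hI.1.1
        have hI' : I = maximalIdeal R := le_antisymm (le_maximalIdeal this.ne_top) hle
        have hh : (maximalIdeal R).height = 0 := by
          rw [Ideal.height_eq_zero_iff, ← hI']
          exact hI
        have := maximalIdeal_height_eq_ringKrullDim (R := R)
        rw [hh, hd] at this
        exact absurd this.symm (by exact_mod_cast d.succ_ne_zero)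
    simp only [Set.mem_iUnion, not_exists, Set.mem_insert_iff, forall_eq_or_imp,
      SetLike.mem_coe] at hx
    obtain ⟨hx2, hxmin⟩ := hx
    have hli : LinearIndependent (ResidueField R)
        fun _ : Fin 1 => (maximalIdeal R).toCotangent ⟨x, hxm⟩ := by
      rw [linearIndependent_unique_iff]
      simpa [Ideal.toCotangent_eq_zero] using hx2
    obtain ⟨hreg, hdim⟩ := quotient_span_of_linearIndependent (fun _ : Fin 1 => ⟨x, hxm⟩) hli
    rw [Set.range_const] at hreg hdim
    have hdim' : ringKrullDim (R ⧸ Ideal.span {x}) = d := by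
      rw [hd] at hdim
      obtain ⟨e, he, hed⟩ := WithBot.exists_natCast_eq_of_add_natCast_eq hdim
      rw [he, Nat.add_right_cancel hed]
    have := ih _ hdim'
    have hxprime : (Ideal.span {x}).IsPrime := (Ideal.Quotient.isDomain_iff_prime _).1 this
    obtain ⟨q, hq, hqx⟩ := Ideal.exists_minimalPrimes_le (bot_le : ⊥ ≤ Ideal.span {x})
    have hqprime := hq.1.1
    suffices q = ⊥ by
      subst this
      exact IsDomain.of_bot_isPrime R
    refine Submodule.eq_bot_of_le_smul_of_le_jacobson_bot (maximalIdeal R) _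
      (IsNoetherian.noetherian _) ?_ (jacobson_eq_maximalIdeal _ bot_ne_top).ge
    intro y hy
    obtain ⟨z, rfl⟩ := Ideal.mem_span_singleton'.1 (hqx hy)
    rw [mul_comm]
    exact Ideal.mul_mem_mul hxm ((hqprime.mem_or_mem hy).resolve_right (hxmin q hq))

theorem IsRegularLocalRing.isDomain (R : Type*) [CommRing R] [IsRegularLocalRing R] :
    IsDomain R :=
  isDomain_of_ringKrullDim_eq _ R (spanFinrank_maximalIdeal (R := R)).symm

open IsLocalRing in
theorem IsRegularLocalRing.isPrime_span_of_linearIndependent {R : Type*} [CommRing R]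
    [IsRegularLocalRing R] {c : ℕ} (g : Fin c → maximalIdeal R)
    (hg : LinearIndependent (ResidueField R) fun i => (maximalIdeal R).toCotangent (g i)) :
    (Ideal.span (Set.range fun i => (g i : R))).IsPrime := by
  have := (quotient_span_of_linearIndependent g hg).1
  exact (Ideal.Quotient.isDomain_iff_prime _).1 (isDomain _)

open IsLocalRing in
theorem IsRegularLocalRing.le_height_span_of_linearIndependent {R : Type*} [CommRing R]
    [IsRegularLocalRing R] {c : ℕ} (g : Fin c → maximalIdeal R)
    (hg : LinearIndependent (ResidueField R) fun i => (maximalIdeal R).toCotangent (g i)) :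
    c ≤ (Ideal.span (Set.range fun i => (g i : R))).height := by
  induction c with
  | zero => simp
  | succ c ih =>
    have hg' : LinearIndependent (ResidueField R)
        fun i => (maximalIdeal R).toCotangent (Fin.init g i) :=
      hg.comp Fin.castSucc (Fin.castSucc_injective c)
    have := isPrime_span_of_linearIndependent g hg
    have := isPrime_span_of_linearIndependent _ hg'
    have hle : Ideal.span (Set.range fun i => (Fin.init g i : R)) ≤
        Ideal.span (Set.range fun i => (g i : R)) := by
      refine Ideal.span_mono ?_
      rintro _ ⟨i, rfl⟩
      exact ⟨i.castSucc, rfl⟩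
    have hne : Ideal.span (Set.range fun i => (Fin.init g i : R)) ≠
        Ideal.span (Set.range fun i => (g i : R)) := fun h => by
      have h1 := (quotient_span_of_linearIndependent g hg).2
      have h2 := (quotient_span_of_linearIndependent _ hg').2
      rw [← spanFinrank_maximalIdeal (R := R)] at h1 h2
      obtain ⟨e, he, hed⟩ := WithBot.exists_natCast_eq_of_add_natCast_eq h1
      obtain ⟨e', he', hed'⟩ := WithBot.exists_natCast_eq_of_add_natCast_eq h2
      rw [h, he, Nat.cast_inj] at he'
      omega
    calc ((c + 1 : ℕ) : ℕ∞) = c + 1 := by push_cast; rfl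
      _ ≤ (Ideal.span (Set.range fun i => (Fin.init g i : R))).height + 1 := by
        gcongr; exact ih _ hg'
      _ ≤ _ := Ideal.height_add_one_le_of_lt_of_isPrime (lt_of_le_of_ne hle hne)

open IsLocalRing in
theorem IsRegularLocalRing.eq_span_of_linearIndependent_of_height_le {R : Type*} [CommRing R]
    [IsRegularLocalRing R] {c : ℕ} (g : Fin c → maximalIdeal R)
    (hg : LinearIndependent (ResidueField R) fun i => (maximalIdeal R).toCotangent (g i))
    (P : Ideal R) (hgP : ∀ i, (g i : R) ∈ P) (hP : P.height ≤ c) :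
    P = Ideal.span (Set.range fun i => (g i : R)) := by
  have := isPrime_span_of_linearIndependent g hg
  refine (Ideal.eq_of_le_of_height_le (Ideal.span _) ?_
    (hP.trans (le_height_span_of_linearIndependent g hg))).symm
  rw [Ideal.span_le]
  rintro _ ⟨i, rfl⟩
  exact hgP i

open IsLocalRing in
theorem IsLocalRing.linearIndependent_toCotangent_localization {S : Type*} [CommRing S]
    (m : Ideal S) [m.IsPrime] {c : ℕ} (g : Fin c → S) (hg : ∀ i, g i ∈ m)
    (h : ∀ s : Fin c → S, ∑ i, s i * g i ∈ m ^ 2 → ∀ i, s i ∈ m) :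
    LinearIndependent (ResidueField (Localization.AtPrime m)) fun i =>
      (maximalIdeal (Localization.AtPrime m)).toCotangent
        ⟨algebraMap S _ (g i),
          (IsLocalization.AtPrime.to_map_mem_maximal_iff (Localization.AtPrime m) m _).2 (hg i)⟩ := by
  rw [Fintype.linearIndependent_iff]
  intro a ha
  choose r hr using fun i => residue_surjective (a i)
  obtain ⟨b, hb⟩ := IsLocalization.exist_integer_multiples_of_finite m.primeCompl r
  choose s hs using hb
  have hr2 : ∑ i, r i * algebraMap S _ (g i) ∈ maximalIdeal (Localization.AtPrime m) ^ 2 := by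
    have hsum : (maximalIdeal (Localization.AtPrime m)).toCotangent (∑ i, r i •
        ⟨algebraMap S _ (g i), (IsLocalization.AtPrime.to_map_mem_maximal_iff
          (Localization.AtPrime m) m _).2 (hg i)⟩) = 0 := by
      rw [← ha, map_sum]
      refine Finset.sum_congr rfl fun i _ => ?_
      rw [map_smul, ← hr]
      rfl
    rw [Ideal.toCotangent_eq_zero] at hsum
    simpa using hsum
  have hs2 : algebraMap S (Localization.AtPrime m) (∑ i, s i * g i) ∈
      (m ^ 2).map (algebraMap S (Localization.AtPrime m)) := by
    rw [Ideal.map_pow, Localization.AtPrime.map_eq_maximalIdeal, map_sum]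
    simp only [map_mul, hs, Algebra.smul_def, mul_assoc, ← Finset.mul_sum]
    exact Ideal.mul_mem_left _ _ hr2
  obtain ⟨u, hu, hus⟩ := (IsLocalization.algebraMap_mem_map_algebraMap_iff m.primeCompl _ _ _).1 hs2
  intro i
  have hsi : s i ∈ m := by
    refine (Ideal.IsPrime.mem_or_mem inferInstance
      (h (fun i => u * s i) ?_ i)).resolve_left hu
    simpa only [mul_assoc, ← Finset.mul_sum] using hus
  rw [← hr, residue_eq_zero_iff]
  have hbr : algebraMap S (Localization.AtPrime m) b * r i ∈ maximalIdeal _ := by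
    rw [← Algebra.smul_def, ← hs]
    exact (IsLocalization.AtPrime.to_map_mem_maximal_iff _ m _).2 hsi
  refine (Ideal.IsPrime.mem_or_mem inferInstance hbr).resolve_left fun hbm => b.2 ?_
  exact (IsLocalization.AtPrime.to_map_mem_maximal_iff _ m _).1 hbm

theorem diffAt_mul {k : Type} [Field k] {N : ℕ} (v0 : Fin N → k)
    (p q : MvPolynomial (Fin N) k) :
    diffAt v0 (p * q) = eval v0 p • diffAt v0 q + eval v0 q • diffAt v0 p := by
  ext w
  simp [diffAt, Derivation.leibniz, Finset.sum_apply, add_mul, Finset.sum_add_distrib, Finset.mul_sum,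
    mul_assoc]

theorem diffAt_sum {k : Type} [Field k] {N : ℕ} {ι : Type*} (v0 : Fin N → k) (s : Finset ι)
    (p : ι → MvPolynomial (Fin N) k) : diffAt v0 (∑ i ∈ s, p i) = ∑ i ∈ s, diffAt v0 (p i) := by
  simp only [diffAt, map_sum, Finset.sum_smul]
  exact Finset.sum_comm

theorem diffAt_eq_zero_of_mem_ker_sq {k : Type} [Field k] {N : ℕ} (v0 : Fin N → k)
    {p : MvPolynomial (Fin N) k} (hp : p ∈ RingHom.ker (eval v0) ^ 2) : diffAt v0 p = 0 := by
  rw [pow_two] at hp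
  refine Submodule.mul_induction_on hp (fun a ha b hb => ?_) fun a b ha hb => ?_
  · rw [diffAt_mul, (RingHom.mem_ker).1 ha, (RingHom.mem_ker).1 hb, zero_smul, zero_smul, add_zero]
  · have := diffAt_sum v0 Finset.univ ![a, b]
    simpa [ha, hb] using this

theorem exists_mul_mem_span_of_mem {k : Type} [Field k] {N c : ℕ}
    (𝔭 : Ideal (MvPolynomial (Fin N) k)) [hprime : 𝔭.IsPrime]
    (hcodim : affineDim k 𝔭 + (c : WithBot ℕ∞) = (N : WithBot ℕ∞))
    (v0 : Fin N → k) (hv0 : ∀ g ∈ 𝔭, eval v0 g = 0)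
    (g : Fin c → MvPolynomial (Fin N) k) (hg : ∀ i, g i ∈ 𝔭)
    (hind : LinearIndependent k fun i => diffAt v0 (g i))
    {f : MvPolynomial (Fin N) k} (hf : f ∈ 𝔭) :
    ∃ u, eval v0 u ≠ 0 ∧ u * f ∈ Ideal.span (Set.range g) := by
  have hprimeker : (RingHom.ker (eval v0)).IsPrime := RingHom.ker_isPrime _
  have hle : 𝔭 ≤ RingHom.ker (eval v0) := hv0
  have hli := IsLocalRing.linearIndependent_toCotangent_localization (RingHom.ker (eval v0)) g
    (fun i => hle (hg i)) fun s hs i => by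
      have h0 := diffAt_eq_zero_of_mem_ker_sq v0 hs
      simp only [diffAt_sum, diffAt_mul, hv0 _ (hg _), zero_smul, add_zero] at h0
      exact Fintype.linearIndependent_iff.1 hind _ h0 i
  have hdisj : Disjoint ((RingHom.ker (eval v0)).primeCompl : Set (MvPolynomial (Fin N) k)) 𝔭 :=
    Set.disjoint_left.2 fun x hx hx' => hx (hle hx')
  have hheight : 𝔭.height ≤ c := by
    obtain ⟨e, he, hec⟩ := WithBot.exists_natCast_eq_of_add_natCast_eq hcodim
    have := Ideal.height_add_ringKrullDim_quotient_le 𝔭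
    rw [← affineDim, he, MvPolynomial.ringKrullDim_of_isNoetherianRing, ringKrullDim_eq_zero_of_field,
      Nat.card_fin, zero_add] at this
    have h : 𝔭.height + e ≤ (N : ℕ∞) := by exact_mod_cast this
    have hN : (N : ℕ∞) = e + c := by exact_mod_cast hec.symm
    rw [add_comm, hN] at h
    exact (ENat.add_le_add_iff_left (ENat.natCast_ne_top e)).1 h
  have heq := IsRegularLocalRing.eq_span_of_linearIndependent_of_height_le _ hli
    (𝔭.map (algebraMap _ (Localization.AtPrime (RingHom.ker (eval v0)))))
    (fun i => Ideal.mem_map_of_mem _ (hg i))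
    ((IsLocalization.height_map_of_disjoint (RingHom.ker (eval v0)).primeCompl 𝔭 hdisj).le.trans
      hheight)
  have hfm := Ideal.mem_map_of_mem (algebraMap _ (Localization.AtPrime (RingHom.ker (eval v0)))) hf
  have hspan : Ideal.span (Set.range fun i =>
      algebraMap _ (Localization.AtPrime (RingHom.ker (eval v0))) (g i)) =
      (Ideal.span (Set.range g)).map (algebraMap _ _) := by
    rw [Ideal.map_span, ← Set.range_comp]
    rfl
  rw [heq, hspan, IsLocalization.algebraMap_mem_map_algebraMap_iff
    (RingHom.ker (eval v0)).primeCompl] at hfm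
  exact hfm

theorem MvPolynomial.homogeneousComponent_mul {σ R : Type*} [CommSemiring R] (n : ℕ)
    (p q : MvPolynomial σ R) :
    homogeneousComponent n (p * q) =
      ∑ ij ∈ Finset.HasAntidiagonal.antidiagonal n,
        homogeneousComponent ij.1 p * homogeneousComponent ij.2 q := by
  classical
  ext d
  simp only [coeff_homogeneousComponent, coeff_sum, coeff_mul]
  rw [Finset.sum_comm]
  split_ifs with hd
  · refine Finset.sum_congr rfl fun x hx => ?_
    rw [Finset.HasAntidiagonal.mem_antidiagonal] at hx
    rw [Finset.sum_eq_single (x.1.degree, x.2.degree)]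
    · simp
    · rintro ⟨i, j⟩ - hij
      simp only [ite_mul, mul_ite, zero_mul, mul_zero]
      split_ifs with h1 h2
      · exact absurd (by rw [h1, h2]) hij
      all_goals rfl
    · intro h
      refine absurd ?_ h
      rw [Finset.HasAntidiagonal.mem_antidiagonal, ← map_add, hx, hd]
  · refine (Finset.sum_eq_zero fun x hx => Finset.sum_eq_zero fun ij hij => ?_).symm
    rw [Finset.HasAntidiagonal.mem_antidiagonal] at hx hij
    simp only [ite_mul, mul_ite, zero_mul, mul_zero]
    split_ifs with h1 h2
    · exact absurd (by rw [← hx, map_add, h1, h2, hij]) hd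
    all_goals rfl


theorem taylorComp_mul {k : Type} [Field k] {N : ℕ} (v0 : Fin N → k) (n : ℕ)
    (p q : MvPolynomial (Fin N) k) :
    taylorComp v0 n (p * q) =
      ∑ ij ∈ Finset.HasAntidiagonal.antidiagonal n, taylorComp v0 ij.1 p * taylorComp v0 ij.2 q := by
  simp only [taylorComp, map_mul, homogeneousComponent_mul]

theorem taylorComp_zero {k : Type} [Field k] {N : ℕ} (v0 : Fin N → k)
    (p : MvPolynomial (Fin N) k) : taylorComp v0 0 p = C (eval v0 p) := by
  rw [taylorComp, homogeneousComponent_zero, ← constantCoeff_eq]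
  congr 1
  induction p using MvPolynomial.induction_on with
  | C a => simp
  | add p q hp hq => simp only [map_add, hp, hq]
  | mul_X p i hp => simp only [map_mul, hp]; simp

theorem taylorComp_sum {k : Type} [Field k] {N : ℕ} {ι : Type*} (v0 : Fin N → k) (n : ℕ)
    (s : Finset ι) (p : ι → MvPolynomial (Fin N) k) :
    taylorComp v0 n (∑ i ∈ s, p i) = ∑ i ∈ s, taylorComp v0 n (p i) := by
  simp only [taylorComp, map_sum]

/-- Let `X ⊆ V = 𝔸^N` be an irreducible closed subvariety of codimension `c`
(encoded by its prime ideal `𝔭 = I_X`, with `dim X + c = N`) and `v0` a smooth `k`-point of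
`X` (a zero of `𝔭` whose Zariski tangent space `⋂_{g ∈ 𝔭} ker(d g|_{v0})` has dimension
`N - c`).  Let `g 1, …, g c ∈ 𝔭` have linearly independent differentials at `v0`. Then for
every `f ∈ 𝔭 = I_X` and every `m ≥ 1`, the derivative `f^{(m)}_{v0}` belongs to the ideal
generated by the `(g i)^{(j)}_{v0}` for `i = 1, …, c` and `1 ≤ j ≤ m`. -/
theorem taylor_component_mem_ideal {k : Type} [Field k] {N : ℕ} (c : ℕ)
    (𝔭 : Ideal (MvPolynomial (Fin N) k)) (hprime : 𝔭.IsPrime)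
    (hcodim : affineDim k 𝔭 + (c : WithBot ℕ∞) = (N : WithBot ℕ∞))
    (v0 : Fin N → k) (hv0 : ∀ g ∈ 𝔭, eval v0 g = 0)
    (hsmooth : Module.finrank k ↥(⨅ g ∈ 𝔭, LinearMap.ker (diffAt v0 g)) + c = N)
    (g : Fin c → MvPolynomial (Fin N) k) (hg : ∀ i, g i ∈ 𝔭)
    (hind : LinearIndependent k fun i => diffAt v0 (g i)) :
    ∀ f ∈ 𝔭, ∀ m : ℕ, 1 ≤ m →
      taylorComp v0 m f ∈
        Ideal.span {q | ∃ i j, 1 ≤ j ∧ j ≤ m ∧ q = taylorComp v0 j (g i)} := by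
  intro f hf m _
  set J : ℕ → Ideal (MvPolynomial (Fin N) k) := fun m =>
    Ideal.span {q | ∃ i j, 1 ≤ j ∧ j ≤ m ∧ q = taylorComp v0 j (g i)}
  have hmono : Monotone J := fun a b hab => Ideal.span_mono <| by
    rintro q ⟨i, j, h1, h2, rfl⟩
    exact ⟨i, j, h1, h2.trans hab, rfl⟩
  have hspan : ∀ h ∈ Ideal.span (Set.range g), ∀ m, taylorComp v0 m h ∈ J m := by
    intro h hh m
    obtain ⟨a, rfl⟩ := (Ideal.mem_span_range_iff_exists_fun).1 hh
    rw [taylorComp_sum]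
    refine Ideal.sum_mem _ fun i _ => ?_
    rw [taylorComp_mul]
    refine Ideal.sum_mem _ fun x hx => Ideal.mul_mem_left _ _ ?_
    rcases Nat.eq_zero_or_pos x.2 with h0 | h0
    · rw [h0, taylorComp_zero, hv0 _ (hg i), C_0]
      exact Ideal.zero_mem _
    · exact Ideal.subset_span ⟨i, x.2, h0, by
        have := Finset.HasAntidiagonal.mem_antidiagonal.1 hx
        omega, rfl⟩
  obtain ⟨u, hu, huf⟩ := exists_mul_mem_span_of_mem 𝔭 hcodim v0 hv0 g hg hind hf
  change taylorComp v0 m f ∈ J m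
  induction m using Nat.strong_induction_on with
  | _ m ih =>
    have hm := hspan _ huf m
    rw [taylorComp_mul, ← Finset.add_sum_erase _ _
      (Finset.HasAntidiagonal.mem_antidiagonal.2 (zero_add m) : ((0, m) : ℕ × ℕ) ∈ _),
      taylorComp_zero] at hm
    have hrest := (Ideal.add_mem_iff_left _ (Ideal.sum_mem _ fun x hx => ?_)).1 hm
    · have := Ideal.mul_mem_left _ (C (eval v0 u)⁻¹) hrest
      rwa [← mul_assoc, ← C_mul, inv_mul_cancel₀ hu, C_1, one_mul] at this
    · obtain ⟨hne, hx⟩ := Finset.mem_erase.1 hx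
      rw [Finset.HasAntidiagonal.mem_antidiagonal] at hx
      have hlt : x.2 < m := by
        refine lt_of_le_of_ne (by omega) fun h => hne (Prod.ext ?_ h)
        change x.1 = 0
        omega
      refine Ideal.mul_mem_left _ _ ?_
      rcases Nat.eq_zero_or_pos x.2 with h0 | h0
      · rw [h0, taylorComp_zero, hv0 f hf, C_0]
        exact Ideal.zero_mem _
      · exact hmono hlt.le (ih _ hlt h0)
end

section
/- Let k be a field, V a finite-dimensional k-vector space, and f̄ = (f_1,…,f_s) a collection of homogeneous polynomials of degree d on V, not all zero. Then g_sym(f̄) ≤ (d+1)·c'(f̄) + d·(s−1); moreover, if d is odd and char(k) ≠ 2, then g_sym(f̄) ≤ d·c'(f̄) + (d−1)·(s−1). -/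
open MvPolynomial

/-- The ideal of `Z^sym_{f̄} ⊆ V × V` for a collection `f̄ = (f 1, …, f s)`: in the
coordinates `(v, x)` (with `v` the `Sum.inl` variables and `x` the `Sum.inr` variables) it is
generated by the `s × s` minors of the `s × n` matrix whose `(i, l)` entry is
`H_{f i}(x)(e_l, v) = ∑ j, v j * (∂_l ∂_j (f i))(x)`; its zero locus is the set of `(v, x)`
where the linear map `v' ↦ (H_{f i}(x)(v', v))_i` has rank `< s`. -/
noncomputable def zSymFamIdeal {k : Type} [Field k] {n s : ℕ}
    (f : Fin s → MvPolynomial (Fin n) k) : Ideal (MvPolynomial (Fin n ⊕ Fin n) k) :=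
  Ideal.span (Set.range fun c : Fin s → Fin n =>
    Matrix.det (Matrix.of fun i i' : Fin s =>
      ∑ j : Fin n, X (Sum.inl j) * rename Sum.inr (pderiv (c i') (pderiv j (f i)))))

/-- The ideal of the locus `S(f̄)` where the Jacobian matrix of `(f 1, …, f s)` has rank
`< s`: it is generated by all `s × s` minors of the Jacobian matrix. -/
noncomputable def jacIdeal {k : Type} [Field k] {n s : ℕ}
    (f : Fin s → MvPolynomial (Fin n) k) : Ideal (MvPolynomial (Fin n) k) :=
  Ideal.span (Set.range fun c : Fin s → Fin n =>
    Matrix.det (Matrix.of fun i j : Fin s => pderiv (c j) (f i)))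

theorem ringKrullDim_le_of_isIntegral {R S : Type*} [CommRing R] [CommRing S] [Algebra R S]
    [Algebra.IsIntegral R S] : ringKrullDim S ≤ ringKrullDim R :=
  Order.krullDim_le_of_strictMono (PrimeSpectrum.comap (algebraMap R S)) fun I J h ↦
    Ideal.IsIntegral.comap_lt_comap (R := R) (I := I.asIdeal) (J := J.asIdeal) h

theorem exists_comap_eq_and_le_height_of_isIntegral {R S : Type*} [CommRing R] [CommRing S]
    [Algebra R S] [Algebra.IsIntegral R S] [FaithfulSMul R S] (n : ℕ) (P : PrimeSpectrum R)
    (hn : (n : ℕ∞) ≤ Order.height P) :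
    ∃ Q : PrimeSpectrum S, PrimeSpectrum.comap (algebraMap R S) Q = P ∧
      (n : ℕ∞) ≤ Order.height Q := by
  induction n generalizing P with
  | zero =>
    obtain ⟨Q, -, hQ, hQP⟩ := Ideal.exists_ideal_over_prime_of_isIntegral P.asIdeal (⊥ : Ideal S)
      (by simp [← RingHom.ker_eq_comap_bot,
        (RingHom.injective_iff_ker_eq_bot _).mp (FaithfulSMul.algebraMap_injective R S)])
    exact ⟨⟨Q, hQ⟩, PrimeSpectrum.ext hQP, by simp⟩
  | succ n ih =>
    obtain ⟨l, rfl, hl⟩ := Order.exists_series_of_le_height P hn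
    have hP' : l.eraseLast.last < l.last := by
      exact l.eraseLast_last_rel_last (by omega)
    have hn' : (n : ℕ∞) ≤ Order.height l.eraseLast.last := by
      have := Order.length_le_height_last (p := l.eraseLast)
      simpa [hl] using this
    generalize l.eraseLast.last = P' at hP' hn'
    generalize l.last = P at hP'
    obtain ⟨Q', hQ', hh⟩ := ih P' hn'
    obtain ⟨Q, hQ, hQp, hQP⟩ := Ideal.exists_ideal_over_prime_of_isIntegral P.asIdeal Q'.asIdeal
      (by have := congrArg PrimeSpectrum.asIdeal hQ'
          simp only [PrimeSpectrum.comap_asIdeal] at this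
          rw [this]; exact hP'.le)
    refine ⟨⟨Q, hQp⟩, PrimeSpectrum.ext hQP, ?_⟩
    have hlt : Q' < ⟨Q, hQp⟩ := by
      refine lt_of_le_of_ne hQ ?_
      rintro rfl
      exact hP'.ne (hQ'.symm.trans (PrimeSpectrum.ext hQP))
    push_cast
    exact (add_le_add_left hh 1).trans (Order.height_add_one_le hlt)

theorem ringKrullDim_eq_of_isIntegral {R S : Type*} [CommRing R] [CommRing S] [Algebra R S]
    [Algebra.IsIntegral R S] [FaithfulSMul R S] : ringKrullDim S = ringKrullDim R := by
  refine le_antisymm ringKrullDim_le_of_isIntegral ?_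
  rcases subsingleton_or_nontrivial R with _ | _
  · rw [ringKrullDim_eq_bot_of_subsingleton]
    exact bot_le
  have := (FaithfulSMul.algebraMap_injective R S).nontrivial
  rw [ringKrullDim, ringKrullDim, Order.krullDim_eq_iSup_height_of_nonempty,
    Order.krullDim_eq_iSup_height_of_nonempty, WithBot.coe_le_coe]
  refine iSup_le fun P ↦ ENat.forall_natCast_le_iff_le.mp fun n hn ↦ ?_
  obtain ⟨Q, -, hQ⟩ := exists_comap_eq_and_le_height_of_isIntegral (S := S) n P hn
  exact le_iSup_of_le Q hQ

/-- The Krull dimension of an affine domain is its transcendence degree. -/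
theorem ringKrullDim_eq_trdeg {k A : Type} [Field k] [CommRing A] [IsDomain A] [Algebra k A]
    [Algebra.FiniteType k A] :
    ∃ r : ℕ, ringKrullDim A = r ∧ Algebra.trdeg k A = r := by
  obtain ⟨r, g, hg, hi⟩ := exists_integral_inj_algHom_of_fg k A
  let := g.toRingHom.toAlgebra
  have : Algebra.IsIntegral (MvPolynomial (Fin r) k) A := ⟨hi⟩
  have : FaithfulSMul (MvPolynomial (Fin r) k) A :=
    (faithfulSMul_iff_algebraMap_injective _ _).mpr hg
  have : IsScalarTower k (MvPolynomial (Fin r) k) A :=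
    .of_algebraMap_eq fun x ↦ (g.commutes x).symm
  refine ⟨r, ?_, ?_⟩
  · rw [ringKrullDim_eq_of_isIntegral (R := MvPolynomial (Fin r) k)]
    simp
  · rw [← trdeg_add_eq k (MvPolynomial (Fin r) k), MvPolynomial.trdeg_of_isDomain,
      trdeg_eq_zero]
    simp

/-- If some of the coordinates of a point of the zero locus of an ideal are algebraically
independent over the ground field, then the dimension of this zero locus is at least the number of
those coordinates. -/
theorem natCard_le_ringKrullDim_quotient {k B σ ι : Type} [Field k] [CommRing B]
    [IsDomain B] [Algebra k B] [Finite σ] (I : Ideal (MvPolynomial σ k)) (z : σ → B)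
    (hI : ∀ p ∈ I, aeval z p = 0) (u : ι → σ) (hu : AlgebraicIndependent k (z ∘ u)) :
    (Nat.card ι : WithBot ℕ∞) ≤ ringKrullDim (MvPolynomial σ k ⧸ I) := by
  have hinj : Function.Injective u := hu.injective.of_comp
  have : Finite ι := Finite.of_injective u hinj
  obtain ⟨q, hq⟩ : ∃ q, q = RingHom.ker (aeval z : MvPolynomial σ k →ₐ[k] B) := ⟨_, rfl⟩
  have hqz : ∀ p ∈ q, aeval z p = 0 := fun p hp ↦ by rwa [hq, RingHom.mem_ker] at hp
  have : q.IsPrime := hq ▸ RingHom.ker_isPrime _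
  have hIq : I ≤ q := fun p hp ↦ by rw [hq, RingHom.mem_ker]; exact hI p hp
  obtain ⟨r, h1, h2⟩ := ringKrullDim_eq_trdeg (k := k) (A := MvPolynomial σ k ⧸ q)
  have hA : AlgebraicIndependent k fun i ↦ Ideal.Quotient.mkₐ k q (X (u i)) := by
    refine AlgebraicIndependent.of_comp (Ideal.Quotient.liftₐ q (aeval z) hqz) ?_
    convert! hu using 1
    ext i
    exact (Ideal.Quotient.lift_mk _ _ _).trans (aeval_X z (u i))
  have := hA.cardinalMk_le_trdeg
  rw [h2, ← Nat.cast_card] at this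
  refine le_trans ?_ (ringKrullDim_le_of_surjective (Ideal.Quotient.factor hIq)
    (Ideal.Quotient.factor_surjective hIq))
  rw [h1]
  exact_mod_cast this

/-- A finite type algebra over which the ambient domain is algebraic contains, among given
generators, as many algebraically independent elements as the transcendence degree. -/
theorem exists_algebraicIndependent_comp {k B σ : Type} [Field k] [CommRing B] [IsDomain B]
    [Algebra k B] (z : σ → B) [Algebra.IsAlgebraic (Algebra.adjoin k (Set.range z)) B] :
    ∃ (ι : Type) (u : ι → σ), AlgebraicIndependent k (z ∘ u) ∧
      Cardinal.mk ι = Algebra.trdeg k B := by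
  obtain ⟨t, ht, hb⟩ := exists_isTranscendenceBasis_subset (R := k) (Set.range z)
  choose u hu using fun x : t ↦ ht x.2
  refine ⟨t, u, ?_, hb.cardinalMk_eq_trdeg⟩
  convert! hb.1 using 1
  ext x
  exact hu x

theorem Ideal.height_le_height_map_mk_comap {R S : Type*} [CommRing R] [CommRing S] {f : R →+* S}
    (hf : Function.Surjective f) {I : Ideal R} (hI : I ≤ RingHom.ker f) (P : Ideal S) [P.IsPrime] :
    P.height ≤ ((P.comap f).map (Ideal.Quotient.mk I)).height := by
  set g := Ideal.Quotient.lift I f hI with hg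
  have hgs : Function.Surjective g := Ideal.Quotient.lift_surjective_of_surjective I hI hf
  have h1 : (P.comap f).map (Ideal.Quotient.mk I) = P.comap g := by
    have : P.comap f = (P.comap g).comap (Ideal.Quotient.mk I) := by
      rw [Ideal.comap_comap]
      rfl
    rw [this, Ideal.map_comap_of_surjective _ Ideal.Quotient.mk_surjective]
  rw [h1]
  have := Order.height_le_height_apply_of_strictMono (PrimeSpectrum.comap g)
    (RingHom.strictMono_comap_of_surjective hgs) ⟨P, ‹_›⟩
  rwa [← PrimeSpectrum.height_eq_orderHeight, ← PrimeSpectrum.height_eq_orderHeight] at this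

open TensorProduct in
theorem isNoetherianRing_tensorProduct_of_finiteType (K A C : Type*) [Field K] [CommRing A]
    [CommRing C] [Algebra K A] [Algebra K C] [Algebra.FiniteType K A] [Algebra.FiniteType K C] :
    IsNoetherianRing (A ⊗[K] C) :=
  have : IsNoetherianRing A := Algebra.FiniteType.isNoetherianRing K A
  Algebra.FiniteType.isNoetherianRing A _

open TensorProduct in
theorem height_ker_add_height_ker_le {K A C : Type*} [Field K] [CommRing A] [CommRing C]
    [Algebra K A] [Algebra K C] [Algebra.FiniteType K A] [Algebra.FiniteType K C]
    (a : A →ₐ[K] K) (c : C →ₐ[K] K) :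
    (RingHom.ker a).height + (RingHom.ker c).height ≤
      (RingHom.ker (Algebra.TensorProduct.productMap a c)).height := by
  set N := RingHom.ker (Algebra.TensorProduct.productMap a c) with hN
  have : IsNoetherianRing A := Algebra.FiniteType.isNoetherianRing K A
  have : IsNoetherianRing (A ⊗[K] C) := isNoetherianRing_tensorProduct_of_finiteType K A C
  have hp : (RingHom.ker a).IsPrime := RingHom.ker_isPrime a
  have : (RingHom.ker c).IsPrime := RingHom.ker_isPrime c
  have hNp : N.IsPrime := RingHom.ker_isPrime _
  have hl : N.LiesOver (RingHom.ker a) := ⟨by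
    ext x
    simp [hN, Ideal.mem_comap, RingHom.mem_ker]⟩
  rw [Ideal.height_eq_height_add_of_liesOver_of_hasGoingDown (RingHom.ker a) N]
  gcongr
  set f : A ⊗[K] C →ₐ[K] C :=
    Algebra.TensorProduct.productMap ((Algebra.ofId K C).comp a) (AlgHom.id K C) with hf
  have hfs : Function.Surjective f := fun x ↦ ⟨1 ⊗ₜ x, by simp [f]⟩
  have hcf : c.comp f = Algebra.TensorProduct.productMap a c := by
    ext <;> simp [f]
  have hNc : N = (RingHom.ker c).comap f.toRingHom := by
    rw [hN, ← hcf]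
    rfl
  conv_rhs => rw [hNc]
  refine Ideal.height_le_height_map_mk_comap (f := f.toRingHom) hfs ?_ (RingHom.ker c)
  rw [Ideal.map_le_iff_le_comap]
  intro x hx
  rw [RingHom.mem_ker] at hx
  simp [f, Ideal.mem_comap, RingHom.mem_ker, hx]

open TensorProduct in
theorem height_ker_add_height_ker_le_height_map_mk {K R A C : Type*} [Field K] [CommRing R]
    [Algebra K R] [CommRing A] [CommRing C] [Algebra K A] [Algebra K C] [Algebra.FiniteType K A]
    [Algebra.FiniteType K C] {n : ℕ} (a : A →ₐ[K] K) (c : C →ₐ[K] K)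
    {α : R →ₐ[K] A} (hα : Function.Surjective α) {γ : MvPolynomial (Fin n) K →ₐ[K] C}
    (hγ : Function.Surjective γ) (φ : MvPolynomial (Fin n) K →ₐ[K] R)
    (hac : c.comp γ = (a.comp α).comp φ) {I : Ideal R}
    (hI : I ≤ RingHom.ker α ⊔ (RingHom.ker γ).map φ) :
    (RingHom.ker a).height + (RingHom.ker c).height ≤
      ((RingHom.ker (a.comp α)).map (Ideal.Quotient.mk I)).height + n := by
  refine (height_ker_add_height_ker_le a c).trans ?_
  set N := RingHom.ker (Algebra.TensorProduct.productMap a c) with hN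
  have hNp : N.IsPrime := RingHom.ker_isPrime _
  have : IsNoetherianRing (A ⊗[K] C) := isNoetherianRing_tensorProduct_of_finiteType K _ _
  set s : Set (A ⊗[K] C) := Set.range fun i : Fin n ↦
    (α (φ (X i))) ⊗ₜ 1 - 1 ⊗ₜ (γ (X i)) with hs
  have hsN : s ⊆ N := by
    rintro _ ⟨i, rfl⟩
    rw [SetLike.mem_coe, hN, RingHom.mem_ker, map_sub,
      Algebra.TensorProduct.productMap_apply_tmul, Algebra.TensorProduct.productMap_apply_tmul,
      map_one, map_one, mul_one, one_mul, sub_eq_zero]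
    exact (DFunLike.congr_fun hac (X i)).symm
  refine (Ideal.height_le_height_add_encard_of_subset s hsN).trans ?_
  have hcard : s.encard ≤ n := by
    rw [hs, ← Set.image_univ]
    refine (Set.encard_image_le _ _).trans ?_
    simp
  refine add_le_add ?_ hcard
  set Q := Ideal.Quotient.mkₐ K (Ideal.span s) with hQ
  set h : R →ₐ[K] _ := Q.comp (Algebra.TensorProduct.includeLeft.comp α) with hh
  have hφ : h.comp φ = Q.comp ((Algebra.TensorProduct.includeRight (R := K) (A := A)).comp γ) := by
    refine MvPolynomial.algHom_ext fun i ↦ ?_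
    exact Ideal.Quotient.eq.mpr (Ideal.subset_span ⟨i, rfl⟩)
  have hsurj : Function.Surjective h := by
    intro y
    obtain ⟨t, rfl⟩ := Ideal.Quotient.mkₐ_surjective K _ y
    induction t with
    | zero => exact ⟨0, by simp⟩
    | add t u ht hu =>
      obtain ⟨x, hx⟩ := ht
      obtain ⟨y, hy⟩ := hu
      exact ⟨x + y, by rw [map_add, hx, hy, map_add]⟩
    | tmul r p =>
      obtain ⟨r, rfl⟩ := hα r
      obtain ⟨p, rfl⟩ := hγ p
      refine ⟨r * φ p, ?_⟩
      have := DFunLike.congr_fun hφ p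
      rw [map_mul, show h (φ p) = _ from this]
      simp only [hh, AlgHom.comp_apply]
      rw [← hQ, ← map_mul]
      congr 1
      simp
  have hspN : Ideal.span s ≤ N := Ideal.span_le.mpr hsN
  have hker : I ≤ RingHom.ker h.toRingHom := by
    refine hI.trans (sup_le ?_ (Ideal.map_le_iff_le_comap.mpr ?_))
    · intro x hx
      rw [RingHom.mem_ker] at hx ⊢
      change Q (α x ⊗ₜ 1) = 0
      rw [hx, TensorProduct.zero_tmul, map_zero]
    · intro x hx
      rw [Ideal.mem_comap, RingHom.mem_ker]
      rw [RingHom.mem_ker] at hx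
      refine (DFunLike.congr_fun hφ x).trans ?_
      change Q (1 ⊗ₜ γ x) = 0
      rw [hx, TensorProduct.tmul_zero, map_zero]
  have := Ideal.isPrime_map_quotientMk_of_isPrime hspN
  have hcomap : RingHom.ker (a.comp α) =
      (N.map (Ideal.Quotient.mk (Ideal.span s))).comap h.toRingHom := by
    have : (N.map (Ideal.Quotient.mk (Ideal.span s))).comap
        (Ideal.Quotient.mk (Ideal.span s)) = N := by
      rw [Ideal.comap_map_mk hspN]
    ext x
    change _ ↔ (α x) ⊗ₜ 1 ∈
      (N.map (Ideal.Quotient.mk (Ideal.span s))).comap (Ideal.Quotient.mk (Ideal.span s))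
    rw [this, hN, RingHom.mem_ker, RingHom.mem_ker, Algebra.TensorProduct.productMap_apply_tmul,
      map_one, mul_one]
    rfl
  rw [hcomap]
  exact Ideal.height_le_height_map_mk_comap (f := h.toRingHom) hsurj hker _

theorem height_map_mk_add_height_map_mk_le {K R : Type*} [Field K] [CommRing R] [Algebra K R]
    [Algebra.FiniteType K R] {n : ℕ} (e : R →ₐ[K] K) (φ : MvPolynomial (Fin n) K →ₐ[K] R)
    {I : Ideal R} (hI : I ≤ RingHom.ker e) {J : Ideal (MvPolynomial (Fin n) K)}
    (hJ : J ≤ RingHom.ker (e.comp φ)) :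
    ((RingHom.ker e).map (Ideal.Quotient.mk I)).height +
      ((RingHom.ker (e.comp φ)).map (Ideal.Quotient.mk J)).height ≤
      ((RingHom.ker e).map (Ideal.Quotient.mk (I ⊔ J.map φ))).height + n := by
  have hae : (RingHom.ker e).map (Ideal.Quotient.mk I) =
      RingHom.ker (Ideal.Quotient.liftₐ I e hI) := by
    have : RingHom.ker e =
        (RingHom.ker (Ideal.Quotient.liftₐ I e hI)).comap (Ideal.Quotient.mk I) := by
      ext x
      rfl
    rw [this, Ideal.map_comap_of_surjective _ Ideal.Quotient.mk_surjective]
  have hce : (RingHom.ker (e.comp φ)).map (Ideal.Quotient.mk J) =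
      RingHom.ker (Ideal.Quotient.liftₐ J (e.comp φ) hJ) := by
    have : RingHom.ker (e.comp φ) =
        (RingHom.ker (Ideal.Quotient.liftₐ J (e.comp φ) hJ)).comap (Ideal.Quotient.mk J) := by
      ext x
      rfl
    rw [this, Ideal.map_comap_of_surjective _ Ideal.Quotient.mk_surjective]
  rw [hae, hce]
  refine height_ker_add_height_ker_le_height_map_mk (Ideal.Quotient.liftₐ I e hI)
    (Ideal.Quotient.liftₐ J (e.comp φ) hJ) (Ideal.Quotient.mkₐ_surjective K I)
    (Ideal.Quotient.mkₐ_surjective K J) φ rfl ?_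
  exact sup_le_sup (Ideal.mk_ker (I := I)).ge (Ideal.map_mono (Ideal.mk_ker (I := J)).ge)

open Polynomial in
theorem coeff_aeval_X_add {K σ : Type*} [CommRing K] [Fintype σ] (G : MvPolynomial σ K) :
    (aeval (fun j ↦ Polynomial.C (X (Sum.inr j)) + Polynomial.C (X (Sum.inl j)) * Polynomial.X :
      σ → (MvPolynomial (σ ⊕ σ) K)[X]) G).coeff 0 = rename Sum.inr G ∧
    (aeval (fun j ↦ Polynomial.C (X (Sum.inr j)) + Polynomial.C (X (Sum.inl j)) * Polynomial.X :
      σ → (MvPolynomial (σ ⊕ σ) K)[X]) G).coeff 1 =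
        ∑ b, X (Sum.inl b) * rename Sum.inr (pderiv b G) := by
  classical
  induction G using MvPolynomial.induction_on with
  | C a =>
    simp [MvPolynomial.algebraMap_eq, Polynomial.algebraMap_apply, Polynomial.coeff_C]
  | add p q hp hq =>
    simp only [map_add, Polynomial.coeff_add, hp.1, hp.2, hq.1, hq.2, mul_add,
      Finset.sum_add_distrib, and_self]
  | mul_X p j hp =>
    rw [map_mul, MvPolynomial.aeval_X, mul_add, ← mul_assoc, Polynomial.coeff_add,
      Polynomial.coeff_add, Polynomial.coeff_mul_C, Polynomial.coeff_mul_C,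
      Polynomial.coeff_mul_X, Polynomial.coeff_mul_X_zero, Polynomial.coeff_mul_C, hp.1, hp.2]
    refine ⟨by simp, ?_⟩
    simp only [Derivation.leibniz, smul_eq_mul, map_add, map_mul, rename_X,
      pderiv_X, mul_add, Finset.sum_add_distrib]
    rw [add_comm]
    congr 1
    · rw [Finset.sum_eq_single j]
      · simp [mul_comm]
      · intro b _ hb
        simp [hb.symm]
      · simp
    · rw [Finset.sum_mul]
      exact Finset.sum_congr rfl fun b _ ↦ by ring

open Polynomial in
theorem aeval_X_add_C_mul_X {K σ : Type*} [CommRing K] (G : MvPolynomial σ K) (t : K) :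
    aeval (fun j ↦ X (Sum.inr j) + MvPolynomial.C t * X (Sum.inl j) :
      σ → MvPolynomial (σ ⊕ σ) K) G =
    (aeval (fun j ↦ Polynomial.C (X (Sum.inr j)) + Polynomial.C (X (Sum.inl j)) * Polynomial.X :
      σ → (MvPolynomial (σ ⊕ σ) K)[X]) G).eval (MvPolynomial.C t) := by
  induction G using MvPolynomial.induction_on with
  | C a => simp [MvPolynomial.algebraMap_eq, Polynomial.algebraMap_apply]
  | add p q hp hq => simp only [map_add, Polynomial.eval_add, hp, hq]
  | mul_X p j hp =>
    rw [map_mul, map_mul, Polynomial.eval_mul, hp, MvPolynomial.aeval_X, MvPolynomial.aeval_X,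
      Polynomial.eval_add, Polynomial.eval_mul, Polynomial.eval_C, Polynomial.eval_C,
      Polynomial.eval_X, mul_comm (MvPolynomial.C t)]

theorem sum_C_mul_eval_C {K τ ι : Type*} [CommRing K] [Fintype ι] {d : ℕ}
    {w t : ι → K} (hw : ∀ e < d, ∑ i, w i * t i ^ e = if e = 1 then 1 else 0)
    {P : Polynomial (MvPolynomial τ K)} (hdeg : P.natDegree < d) :
    ∑ i, C (w i) * P.eval (C (t i)) = P.coeff 1 := by
  simp_rw [Polynomial.eval_eq_sum_range' hdeg, Finset.mul_sum]
  rw [Finset.sum_comm]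
  have (e : ℕ) (he : e ∈ Finset.range d) :
      ∑ i, C (w i) * (P.coeff e * C (t i) ^ e) = if e = 1 then P.coeff 1 else 0 := by
    have := congrArg (fun x ↦ P.coeff e * (C x : MvPolynomial τ K))
      (hw e (Finset.mem_range.mp he))
    simp only [map_sum, map_mul, map_pow, Finset.mul_sum] at this
    refine (Finset.sum_congr rfl fun i _ ↦ by ring).trans (this.trans ?_)
    split_ifs with h <;> simp [h]
  rw [Finset.sum_congr rfl this, Finset.sum_ite_eq']
  split_ifs with h
  · rfl
  · exact (Polynomial.coeff_eq_zero_of_natDegree_lt (by rw [Finset.mem_range] at h; omega)).symm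

theorem sum_X_mul_rename_pderiv {K σ ι : Type*} [CommRing K] [Fintype σ] [Fintype ι] {d : ℕ}
    {w t : ι → K} (hw : ∀ e < d, ∑ i, w i * t i ^ e = if e = 1 then 1 else 0)
    {G : MvPolynomial σ K} (hG : G.totalDegree < d ∨ G = 0) :
    ∑ b, X (Sum.inl b) * rename Sum.inr (pderiv b G) =
      ∑ i, C (w i) * aeval (fun j ↦ X (Sum.inr j) +
        C (t i) * X (Sum.inl j) : σ → MvPolynomial (σ ⊕ σ) K) G := by
  rcases hG with hG | rfl
  · simp_rw [aeval_X_add_C_mul_X]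
    rw [← (coeff_aeval_X_add G).2, sum_C_mul_eval_C hw]
    rw [← aeval_map_algebraMap (MvPolynomial (σ ⊕ σ) K)]
    refine lt_of_le_of_lt
      (MvPolynomial.aeval_natDegree_le _ (Finset.sup_mono (support_map_subset _ _)) (n := 1) _
      fun i ↦ ?_) (by rwa [mul_one])
    compute_degree
  · simp

theorem exists_le_ker_and_le_height {K : Type*} [Field K] [IsAlgClosed K] {σ : Type*} [Finite σ]
    {I : Ideal (MvPolynomial σ K)} {r : ℕ}
    (hr : (r : WithBot ℕ∞) ≤ ringKrullDim (MvPolynomial σ K ⧸ I)) :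
    ∃ p : σ → K, I ≤ RingHom.ker (aeval p : MvPolynomial σ K →ₐ[K] K) ∧
      (r : ℕ∞) ≤ ((RingHom.ker (aeval p : MvPolynomial σ K →ₐ[K] K)).map
        (Ideal.Quotient.mk I)).height := by
  have hle := ringKrullDim_quotient_le I
  have : FiniteRingKrullDim (MvPolynomial σ K ⧸ I) := by
    refine finiteRingKrullDim_iff_ne_bot_and_top.mpr ⟨?_, ?_⟩
    · intro h
      rw [h] at hr
      simp at hr
    · intro h
      rw [h, MvPolynomial.ringKrullDim_of_isNoetherianRing, ringKrullDim_eq_zero_of_field,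
        zero_add, top_le_iff] at hle
      exact absurd hle (WithBot.coe_injective.ne (ENat.natCast_ne_top _))
  obtain ⟨M, hM, hMh⟩ := Ideal.exists_isMaximal_height (R := MvPolynomial σ K ⧸ I)
  have hM' := Ideal.comap_isMaximal_of_surjective (Ideal.Quotient.mk I)
    Ideal.Quotient.mk_surjective (K := M)
  obtain ⟨p, hp⟩ := MvPolynomial.isMaximal_iff_eq_vanishingIdeal_singleton.mp hM'
  have hk : RingHom.ker (aeval p : MvPolynomial σ K →ₐ[K] K) = M.comap (Ideal.Quotient.mk I) := by
    ext q
    rw [hp, mem_vanishingIdeal_singleton_iff]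
    rfl
  refine ⟨p, ?_, ?_⟩
  · rw [hk]
    intro x hx
    rw [Ideal.mem_comap, Ideal.Quotient.eq_zero_iff_mem.mpr hx]
    exact zero_mem _
  · rw [hk, Ideal.map_comap_of_surjective _ Ideal.Quotient.mk_surjective, ← WithBot.coe_le_coe,
      hMh]
    exact hr

theorem Ideal.height_map_mk_bot {R : Type*} [CommRing R] (I : Ideal R) :
    (I.map (Ideal.Quotient.mk ⊥)).height = I.height := by
  rw [← RingEquiv.height_comap (RingEquiv.quotientBot R).symm]
  exact congrArg Ideal.height (Ideal.comap_map_mk bot_le)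

theorem natCard_le_height_ker_aeval {K : Type*} [Field K] [IsAlgClosed K] {σ : Type*} [Finite σ]
    (p : σ → K) :
    (Nat.card σ : ℕ∞) ≤ (RingHom.ker (aeval p : MvPolynomial σ K →ₐ[K] K)).height := by
  obtain ⟨q, -, hq⟩ := exists_le_ker_and_le_height (K := K) (σ := σ) (I := ⊥) (r := Nat.card σ) (by
    rw [ringKrullDim_eq_of_ringEquiv (RingEquiv.quotientBot _)]
    simp)
  set u : MvPolynomial σ K ≃ₐ[K] MvPolynomial σ K :=
    AlgEquiv.ofAlgHom (aeval fun i ↦ X i + C (q i - p i)) (aeval fun i ↦ X i + C (p i - q i))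
      (by ext1 i; simp [sub_eq_add_neg, add_assoc])
      (by ext1 i; simp [sub_eq_add_neg, add_assoc]) with hu
  have hc : RingHom.ker (aeval q : MvPolynomial σ K →ₐ[K] K) =
      (RingHom.ker (aeval p : MvPolynomial σ K →ₐ[K] K)).comap u.toRingEquiv := by
    have : (aeval q : MvPolynomial σ K →ₐ[K] K) = (aeval p).comp u.toAlgHom := by
      ext i
      simp [hu]
    rw [this]
    rfl
  refine hq.trans ?_
  have h := RingEquiv.height_comap u.toRingEquiv
    (RingHom.ker (aeval p : MvPolynomial σ K →ₐ[K] K))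
  rw [← h, ← hc, Ideal.height_map_mk_bot]

theorem le_height_map_mk_iSup {K R : Type*} [Field K] [CommRing R] [Algebra K R]
    [Algebra.FiniteType K R] {n : ℕ} {ι : Type*} (e : R →ₐ[K] K) (p : Fin n → K)
    (φ : ι → MvPolynomial (Fin n) K →ₐ[K] R) (hφ : ∀ i, e.comp (φ i) = aeval p)
    {J : Ideal (MvPolynomial (Fin n) K)}
    (hJ : J ≤ RingHom.ker (aeval p : MvPolynomial (Fin n) K →ₐ[K] K)) {r h : ℕ∞}
    (hr : r ≤ ((RingHom.ker (aeval p : MvPolynomial (Fin n) K →ₐ[K] K)).map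
      (Ideal.Quotient.mk J)).height) (hh : h ≤ (RingHom.ker e).height) (s : Finset ι) :
    ⨆ i ∈ s, J.map (φ i) ≤ RingHom.ker e ∧
    h + s.card * r ≤
      ((RingHom.ker e).map (Ideal.Quotient.mk (⨆ i ∈ s, J.map (φ i)))).height + s.card * n := by
  classical
  induction s using Finset.induction_on with
  | empty =>
    have hbot : ⨆ i ∈ (∅ : Finset ι), J.map (φ i) = ⊥ := by simp
    rw [hbot, Ideal.height_map_mk_bot]
    simpa using hh
  | insert i s hi ih =>
    rw [Finset.iSup_insert, sup_comm, Finset.card_insert_of_notMem hi]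
    have hJ' : J ≤ RingHom.ker (e.comp (φ i)) := by rwa [hφ]
    refine ⟨sup_le ih.1 (Ideal.map_le_iff_le_comap.mpr hJ'), ?_⟩
    have := height_map_mk_add_height_map_mk_le e (φ i) ih.1 hJ'
    rw [hφ] at this
    push_cast
    calc h + (s.card + 1) * r = h + s.card * r + r := by ring
      _ ≤ _ := add_le_add ih.2 hr
      _ = _ := add_right_comm _ _ _
      _ ≤ _ := add_le_add_left this _
      _ = _ := by ring

theorem exists_sum_mul_pow_eq {K : Type*} [Field K] {m : ℕ} {t : Fin m → K}
    (ht : Function.Injective t) (g : ℕ → K) :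
    ∃ w : Fin m → K, ∀ e < m, ∑ i, w i * t i ^ e = g e := by
  have hu : IsUnit (Matrix.vandermonde t).det :=
    (Matrix.det_vandermonde_ne_zero_iff.mpr ht).isUnit
  refine ⟨Matrix.vecMul (fun e : Fin m ↦ g e) (Matrix.vandermonde t)⁻¹, fun e he ↦ ?_⟩
  have : Matrix.vecMul (Matrix.vecMul (fun e : Fin m ↦ g e) (Matrix.vandermonde t)⁻¹)
      (Matrix.vandermonde t) = fun e : Fin m ↦ g e := by
    rw [Matrix.vecMul_vecMul, Matrix.nonsing_inv_mul _ hu, Matrix.vecMul_one]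
  exact congrFun this ⟨e, he⟩

/-- There is a numerical differentiation formula with `d` nodes, exact on the polynomials of degree
less than `d`. -/
theorem exists_weights (K : Type*) [Field K] [Infinite K] (d : ℕ) :
    ∃ w t : Fin d → K, ∀ e < d, ∑ i, w i * t i ^ e = if e = 1 then 1 else 0 := by
  set t : Fin d → K := fun i ↦ Infinite.natEmbedding K i with ht
  obtain ⟨w, hw⟩ := exists_sum_mul_pow_eq (t := t)
    ((Infinite.natEmbedding K).injective.comp Fin.val_injective) fun e ↦ if e = 1 then 1 else 0
  exact ⟨w, t, hw⟩

/-- There is a symmetric numerical differentiation formula with `2 * r` nodes, exact on the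
polynomials of degree at most `2 * r`. -/
theorem exists_symmetric_weights (K : Type*) [Field K] [IsAlgClosed K] (h2 : (2 : K) ≠ 0)
    (r : ℕ) :
    ∃ w t : Fin r ⊕ Fin r → K,
      ∀ e < 2 * r + 1, ∑ i, w i * t i ^ e = if e = 1 then 1 else 0 := by
  have : Infinite K := IsAlgClosed.instInfinite
  have : Infinite {x : K // x ≠ 0} := (Set.finite_singleton (0 : K)).infinite_compl.to_subtype
  set b : Fin r → K := fun i ↦ (Infinite.natEmbedding {x : K // x ≠ 0} i).1 with hb
  have hb0 (i : Fin r) : b i ≠ 0 := (Infinite.natEmbedding {x : K // x ≠ 0} i).2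
  have hbi : Function.Injective b := Subtype.val_injective.comp
    ((Infinite.natEmbedding {x : K // x ≠ 0}).injective.comp Fin.val_injective)
  obtain ⟨u, hu⟩ := exists_sum_mul_pow_eq hbi fun e ↦ if e = 0 then 1 else 0
  choose c hc using fun i ↦ IsAlgClosed.exists_pow_nat_eq (b i) two_pos
  have hc0 (i : Fin r) : c i ≠ 0 := by
    intro h
    exact hb0 i (by rw [← hc, h]; simp)
  refine ⟨Sum.elim (fun i ↦ u i / (2 * c i)) (fun i ↦ -(u i / (2 * c i))),
    Sum.elim c (fun i ↦ -c i), fun e he ↦ ?_⟩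
  simp only [Fintype.sum_sum_type, Sum.elim_inl, Sum.elim_inr, ← Finset.sum_add_distrib]
  rcases Nat.even_or_odd' e with ⟨q, rfl | rfl⟩
  · rw [if_neg (by omega)]
    refine Finset.sum_eq_zero fun i _ ↦ ?_
    rw [(even_two_mul q).neg_pow]
    ring
  · have := hu q (by omega)
    simp only [Nat.add_eq_right, mul_eq_zero, OfNat.ofNat_ne_zero, false_or]
    rw [← this]
    refine Finset.sum_congr rfl fun i _ ↦ ?_
    rw [(odd_two_mul_add_one q).neg_pow, pow_succ, pow_mul, hc]
    have := hc0 i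
    field_simp
    ring

theorem exists_vecMul_eq_zero_of_det_submatrix_eq_zero {F : Type*} [Field F] {n s : ℕ}
    (M : Matrix (Fin s) (Fin n) F) (hM : ∀ c : Fin s → Fin n, (M.submatrix id c).det = 0) :
    ∃ l : Fin s → F, l ≠ 0 ∧ Matrix.vecMul l M = 0 := by
  by_contra! hcon
  have hrows : LinearIndependent F M.row := by
    rw [← Matrix.vecMul_injective_iff]
    refine (injective_iff_map_eq_zero (Matrix.vecMulLinear M)).mpr fun l hl ↦ ?_
    by_contra h
    exact hcon l h hl
  have hrank : Module.finrank F (Submodule.span F (Set.range M.col)) = s := by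
    rw [← Matrix.rank_eq_finrank_span_cols, hrows.rank_matrix, Fintype.card_fin]
  obtain ⟨g, hg, -, hi⟩ := Submodule.exists_fun_fin_finrank_span_eq F (Set.range M.col)
  choose c hc using hg
  have h := hM (c ∘ Fin.cast hrank.symm)
  refine (Matrix.isUnit_iff_isUnit_det _).not.mpr (by rw [h]; exact not_isUnit_zero)
    (Matrix.linearIndependent_cols_iff_isUnit.mp ?_)
  convert! hi.comp (Fin.cast hrank.symm) (Fin.cast_injective _) using 1
  ext i j
  exact congrFun (hc _) j

theorem Ideal.det_mem_of_sum_mul_mem {R : Type*} [CommRing R] (I : Ideal R) {s : ℕ}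
    (M : Matrix (Fin s) (Fin s) R) (l : Fin s → R) {i₀ : Fin s} (hl : l i₀ = 1)
    (h : ∀ j, ∑ i, l i * M i j ∈ I) : M.det ∈ I := by
  have h0 (j) : Matrix.vecMul l (M * M.adjugate) j ∈ I := by
    rw [← Matrix.vecMul_vecMul]
    simp only [Matrix.vecMul, dotProduct]
    exact Ideal.sum_mem I fun i _ ↦ I.mul_mem_right (M.adjugate i j) (h i)
  have := h0 i₀
  rwa [Matrix.mul_adjugate, Matrix.vecMul_smul, Matrix.vecMul_one, Pi.smul_apply, hl, smul_eq_mul,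
    mul_one] at this

theorem MvPolynomial.pderiv_comm {R σ : Type*} [CommRing R] (i j : σ) (p : MvPolynomial σ R) :
    pderiv i (pderiv j p) = pderiv j (pderiv i p) := by
  classical
  have : ⁅pderiv (R := R) i, pderiv j⁆ =
      (0 : Derivation R (MvPolynomial σ R) (MvPolynomial σ R)) := by
    refine MvPolynomial.derivation_ext fun l ↦ ?_
    simp only [Derivation.commutator_apply, pderiv_X, Derivation.zero_apply]
    rw [Pi.single_apply, Pi.single_apply]
    split_ifs <;> simp
  have := DFunLike.congr_fun this p
  rwa [Derivation.commutator_apply, Derivation.zero_apply, sub_eq_zero] at this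

theorem totalDegree_sum_C_mul_pderiv_lt {K : Type*} [CommRing K] {σ : Type*} {d s : ℕ}
    {f : Fin s → MvPolynomial σ K} (hf : ∀ i, (f i).IsHomogeneous d) (l : Fin s → K) (j : σ) :
    (∑ i, C (l i) * pderiv j (f i)).totalDegree < d ∨ ∑ i, C (l i) * pderiv j (f i) = 0 := by
  rcases Nat.eq_zero_or_pos d with rfl | hd
  · right
    refine Finset.sum_eq_zero fun i _ ↦ ?_
    rw [totalDegree_eq_zero_iff_eq_C.mp ((totalDegree_zero_iff_isHomogeneous _).mpr (hf i)),
      pderiv_C, mul_zero]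
  · left
    have : (∑ i, C (l i) * pderiv j (f i)).IsHomogeneous (d - 1) :=
      IsHomogeneous.sum _ _ _ fun i _ ↦ (hf i).pderiv.C_mul _
    exact this.totalDegree_le.trans_lt (by omega)

theorem zSymFamIdeal_le {K : Type} [Field K] {n d s : ℕ} {ι : Type*} [Fintype ι]
    {f : Fin s → MvPolynomial (Fin n) K} (hf : ∀ i, (f i).IsHomogeneous d) {l : Fin s → K}
    {i₀ : Fin s} (hl : l i₀ = 1) {w t : ι → K}
    (hw : ∀ e < d, ∑ i, w i * t i ^ e = if e = 1 then 1 else 0) :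
    zSymFamIdeal f ≤ ⨆ i ∈ Finset.univ,
      (Ideal.span (Set.range fun j ↦ ∑ i, C (l i) * pderiv j (f i))).map
        (aeval fun j ↦ X (Sum.inr j) + C (t i) * X (Sum.inl j) :
          MvPolynomial (Fin n) K →ₐ[K] MvPolynomial (Fin n ⊕ Fin n) K) := by
  refine Ideal.span_le.mpr ?_
  rintro _ ⟨c, rfl⟩
  refine Ideal.det_mem_of_sum_mul_mem _ _ (fun i ↦ C (l i)) (i₀ := i₀) (by simp [hl]) fun a ↦ ?_
  have : ∑ i, C (l i) * Matrix.of (fun i i' : Fin s ↦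
      ∑ j : Fin n, X (Sum.inl j) * rename Sum.inr (pderiv (c i') (pderiv j (f i)))) i a =
      ∑ j : Fin n, X (Sum.inl j) *
        rename Sum.inr (pderiv j (∑ i, C (l i) * pderiv (c a) (f i))) := by
    simp only [Matrix.of_apply, Finset.mul_sum, map_sum]
    rw [Finset.sum_comm]
    refine Finset.sum_congr rfl fun j _ ↦ Finset.sum_congr rfl fun i _ ↦ ?_
    rw [pderiv_C_mul, map_mul, rename_C, pderiv_comm]
    ring
  rw [this, sum_X_mul_rename_pderiv hw (totalDegree_sum_C_mul_pderiv_lt hf l (c a))]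
  refine Ideal.sum_mem _ fun i _ ↦ Ideal.mul_mem_left _ _ ?_
  refine Ideal.mem_iSup_of_mem i (Ideal.mem_iSup_of_mem (Finset.mem_univ i) ?_)
  exact Ideal.mem_map_of_mem _ (Ideal.subset_span ⟨c a, rfl⟩)

theorem map_mem_zSymFamIdeal {k K : Type} [Field k] [Field K] (g : k →+* K) {n s : ℕ}
    (f : Fin s → MvPolynomial (Fin n) k) {q : MvPolynomial (Fin n ⊕ Fin n) k}
    (hq : q ∈ zSymFamIdeal f) : map g q ∈ zSymFamIdeal fun i ↦ map g (f i) := by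
  suffices zSymFamIdeal f ≤ (zSymFamIdeal fun i ↦ map g (f i)).comap (map g) from this hq
  refine Ideal.span_le.mpr ?_
  rintro _ ⟨c, rfl⟩
  refine Ideal.subset_span ⟨c, ?_⟩
  rw [RingHom.map_det]
  refine congrArg Matrix.det (Matrix.ext fun i j ↦ ?_)
  simp [pderiv_map, map_rename]

theorem trdeg_eq_of_isAlgebraic (k : Type*) {A K : Type} [CommRing k] [CommRing A] [CommRing K]
    [IsDomain k] [NoZeroDivisors K] [Nontrivial A] [Algebra k A] [Algebra k K] [Algebra A K]
    [IsScalarTower k A K] [FaithfulSMul k A] [FaithfulSMul A K] [Algebra.IsAlgebraic A K] :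
    Algebra.trdeg k K = Algebra.trdeg k A := by
  rw [← trdeg_add_eq k A, trdeg_eq_zero (R := A), add_zero]

theorem trdeg_adjoin_le {k F : Type} [Field k] [CommRing F] [IsDomain F] [Algebra k F]
    (S : Set F) : Algebra.trdeg k (Algebra.adjoin k S) ≤ Cardinal.mk S := by
  have : Algebra.IsAlgebraic (Algebra.adjoin k ((↑) ⁻¹' S : Set (Algebra.adjoin k S)))
      (Algebra.adjoin k S) :=
    ⟨fun x ↦ isAlgebraic_algebraMap (A := Algebra.adjoin k S)
      (⟨x, by rw [Algebra.adjoin_adjoin_coe_preimage]; trivial⟩ :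
        Algebra.adjoin k ((↑) ⁻¹' S : Set (Algebra.adjoin k S)))⟩
  refine (Algebra.IsAlgebraic.trdeg_le_cardinalMk k
    ((↑) ⁻¹' S : Set (Algebra.adjoin k S))).trans ?_
  exact Cardinal.mk_preimage_of_injective _ _ Subtype.val_injective

theorem trdeg_algebraicClosure (k L F : Type) [Field k] [Field L] [Field F] [Algebra k L]
    [Algebra L F] [Algebra k F] [IsScalarTower k L F] :
    Algebra.trdeg k (algebraicClosure L F) = Algebra.trdeg k L := by
  have := algebraicClosure.isAlgebraic L F
  exact trdeg_eq_of_isAlgebraic k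

open IntermediateField.algebraAdjoinAdjoin in
theorem exists_isAlgClosed_trdeg_le {k F : Type} [Field k] [Field F] [Algebra k F] [IsAlgClosed F]
    (S : Set F) : ∃ K : IntermediateField k F, IsAlgClosed K ∧ S ⊆ K ∧
      Algebra.trdeg k K ≤ Cardinal.mk S := by
  refine ⟨(algebraicClosure (IntermediateField.adjoin k S) F).restrictScalars k,
    (algebraicClosure.isAlgClosure (IntermediateField.adjoin k S) F).isAlgClosed, ?_, ?_⟩
  · intro x hx
    exact (algebraicClosure (IntermediateField.adjoin k S) F).algebraMap_mem
      ⟨x, IntermediateField.subset_adjoin k S hx⟩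
  · have h1 := trdeg_algebraicClosure k (IntermediateField.adjoin k S) F
    have h2 : Algebra.trdeg k (IntermediateField.adjoin k S) =
        Algebra.trdeg k (Algebra.adjoin k S) := by
      have : Algebra.IsAlgebraic (Algebra.adjoin k S) (IntermediateField.adjoin k S) :=
        IsLocalization.isAlgebraic _ (nonZeroDivisors _)
      exact trdeg_eq_of_isAlgebraic k
    exact (h1.trans h2).le.trans (trdeg_adjoin_le S)

theorem Ideal.exists_isPrime_le_ringKrullDim_quotient {R : Type*} [CommRing R] {I : Ideal R}
    {a : ℕ} (ha : (a : WithBot ℕ∞) ≤ ringKrullDim (R ⧸ I)) :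
    ∃ Q : Ideal R, Q.IsPrime ∧ I ≤ Q ∧ (a : WithBot ℕ∞) ≤ ringKrullDim (R ⧸ Q) := by
  obtain ⟨l, rfl⟩ := Order.le_krullDim_iff.mp ha
  have h1 := Order.length_le_coheight_head (p := l)
  generalize l.head = P at h1
  set f := (Ideal.Quotient.mk P.asIdeal).comp (Ideal.Quotient.mk I) with hf
  have hfs : Function.Surjective f :=
    Ideal.Quotient.mk_surjective.comp Ideal.Quotient.mk_surjective
  refine ⟨RingHom.ker f, RingHom.ker_isPrime f, fun x hx ↦ ?_, ?_⟩
  · rw [RingHom.mem_ker, hf, RingHom.comp_apply, Ideal.Quotient.eq_zero_iff_mem.mpr hx, map_zero]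
  · rw [ringKrullDim_eq_of_ringEquiv (RingHom.quotientKerEquivOfSurjective hfs),
      ringKrullDim_quotient]
    have : PrimeSpectrum.zeroLocus (P.asIdeal : Set (R ⧸ I)) = Set.Ici P := by
      ext Q
      rfl
    rw [this, ← Order.coheight_eq_krullDim_Ici]
    exact_mod_cast h1

/-- A field extension does not increase the dimension of the zero locus of an ideal. -/
theorem le_ringKrullDim_quotient_of_map_mem {k K σ : Type} [Field k] [Field K] [Algebra k K]
    [Finite σ] {I : Ideal (MvPolynomial σ k)} {J : Ideal (MvPolynomial σ K)}
    (hIJ : ∀ p ∈ I, map (algebraMap k K) p ∈ J) {r : ℕ}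
    (hr : (r : WithBot ℕ∞) ≤ ringKrullDim (MvPolynomial σ K ⧸ J)) :
    (r : WithBot ℕ∞) ≤ ringKrullDim (MvPolynomial σ k ⧸ I) := by
  obtain ⟨Q, hQ, hJQ, hrQ⟩ := Ideal.exists_isPrime_le_ringKrullDim_quotient hr
  obtain ⟨m, h1, h2⟩ := ringKrullDim_eq_trdeg (k := K) (A := MvPolynomial σ K ⧸ Q)
  set z : σ → MvPolynomial σ K ⧸ Q := fun i ↦ Ideal.Quotient.mkₐ K Q (X i) with hz
  have hmk : aeval z = Ideal.Quotient.mkₐ K Q := by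
    ext i
    simp [hz]
  have : Algebra.IsAlgebraic (Algebra.adjoin K (Set.range z)) (MvPolynomial σ K ⧸ Q) := by
    refine ⟨fun x ↦ isAlgebraic_algebraMap
      (⟨x, ?_⟩ : Algebra.adjoin K (Set.range z))⟩
    rw [Algebra.adjoin_range_eq_range_aeval, hmk]
    exact Ideal.Quotient.mk_surjective x
  obtain ⟨ι, u, hu, hι⟩ := exists_algebraicIndependent_comp (k := K) z
  have hm : Nat.card ι = m := by
    rw [Nat.card, hι, h2, Cardinal.toNat_natCast]
  rw [h1, ← hm] at hrQ
  refine hrQ.trans (natCard_le_ringKrullDim_quotient I z (fun p hp ↦ ?_) u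
    (hu.restrictScalars (algebraMap k K).injective))
  rw [← aeval_map_algebraMap K, hmk]
  exact Ideal.Quotient.eq_zero_iff_mem.mpr (hJQ (hIJ p hp))

theorem exists_isAlgClosed_isAlgebraic (k B : Type) [Field k] [CommRing B] [IsDomain B]
    [Algebra k B] : ∃ (F : Type) (_ : Field F) (_ : IsAlgClosed F) (_ : Algebra k F)
      (_ : Algebra B F), IsScalarTower k B F ∧ FaithfulSMul B F ∧ Algebra.IsAlgebraic B F := by
  have := IsLocalization.isAlgebraic (FractionRing B) (nonZeroDivisors B)
  refine ⟨AlgebraicClosure (FractionRing B), inferInstance, inferInstance, inferInstance,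
    inferInstance, inferInstance, ?_, Algebra.IsAlgebraic.trans B (FractionRing B) _⟩
  refine (faithfulSMul_iff_algebraMap_injective _ _).mpr ?_
  rw [IsScalarTower.algebraMap_eq B (FractionRing B) (AlgebraicClosure (FractionRing B))]
  exact (algebraMap (FractionRing B) (AlgebraicClosure (FractionRing B))).injective.comp
    (IsFractionRing.injective B (FractionRing B))

theorem exists_isAlgClosed_point_trdeg_eq {k σ : Type} [Field k] [Finite σ]
    (Q : Ideal (MvPolynomial σ k)) [Q.IsPrime] :
    ∃ (F : Type) (_ : Field F) (_ : IsAlgClosed F) (_ : Algebra k F) (z : σ → F) (m : ℕ),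
      (∀ p ∈ Q, aeval z p = 0) ∧ Algebra.IsAlgebraic (Algebra.adjoin k (Set.range z)) F ∧
      ringKrullDim (MvPolynomial σ k ⧸ Q) = m ∧ Algebra.trdeg k F = m := by
  obtain ⟨m, h1, h2⟩ := ringKrullDim_eq_trdeg (k := k) (A := MvPolynomial σ k ⧸ Q)
  let B := MvPolynomial σ k ⧸ Q
  obtain ⟨F, _, _, _, _, _, hfaith, halg⟩ := exists_isAlgClosed_isAlgebraic k B
  have hFk : Algebra.trdeg k F = m := (trdeg_eq_of_isAlgebraic k (A := B) (K := F)).trans h2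
  set z : σ → F := fun i ↦ algebraMap B F (Ideal.Quotient.mkₐ k Q (X i)) with hz
  have hmk : aeval z = (IsScalarTower.toAlgHom k B F).comp (Ideal.Quotient.mkₐ k Q) := by
    ext i
    simp only [hz, aeval_X]
    rfl
  have hrange : ∀ b : B, algebraMap B F b ∈ Algebra.adjoin k (Set.range z) := by
    intro b
    obtain ⟨p, rfl⟩ := Ideal.Quotient.mk_surjective b
    rw [Algebra.adjoin_range_eq_range_aeval, hmk]
    exact ⟨p, rfl⟩
  refine ⟨F, inferInstance, inferInstance, inferInstance, z, m, fun p hp ↦ ?_, ?_, h1, hFk⟩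
  · rw [hmk, AlgHom.comp_apply, Ideal.Quotient.mkₐ_eq_mk, Ideal.Quotient.eq_zero_iff_mem.mpr hp,
      map_zero]
  · refine ⟨fun x ↦ ?_⟩
    obtain ⟨p, hp0, hp⟩ := halg.isAlgebraic x
    let g : B →+* Algebra.adjoin k (Set.range z) := (algebraMap B F).codRestrict _ hrange
    have hg : Function.Injective g := fun x y hxy ↦
      FaithfulSMul.algebraMap_injective B F (congrArg Subtype.val hxy)
    refine ⟨p.map g, (Polynomial.map_ne_zero_iff hg).mpr hp0, ?_⟩
    rw [Polynomial.aeval_def, Polynomial.eval₂_map]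
    exact hp

theorem isAlgebraic_adjoin_of_isScalarTower (k K : Type*) {F : Type*} [Field k] [Field K] [Field F]
    [Algebra k K] [Algebra k F] [Algebra K F] [IsScalarTower k K F] (S : Set F)
    [Algebra.IsAlgebraic (Algebra.adjoin k S) F] : Algebra.IsAlgebraic (Algebra.adjoin K S) F := by
  have hle : Algebra.adjoin k S ≤ (Algebra.adjoin K S).restrictScalars k :=
    Algebra.adjoin_le Algebra.subset_adjoin
  refine ⟨fun x ↦ ?_⟩
  obtain ⟨p, hp0, hp⟩ := Algebra.IsAlgebraic.isAlgebraic (R := Algebra.adjoin k S) x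
  set g : Algebra.adjoin k S →+* Algebra.adjoin K S := (Subalgebra.inclusion hle).toRingHom
  refine ⟨p.map g, (Polynomial.map_ne_zero_iff (Subalgebra.inclusion_injective hle)).mpr hp0, ?_⟩
  rw [Polynomial.aeval_def, Polynomial.eval₂_map]
  exact hp

theorem exists_isAlgClosed_le_ringKrullDim_quotient {k : Type} [Field k] {n s : ℕ}
    (f : Fin s → MvPolynomial (Fin n) k) {a : ℕ}
    (ha : (a : WithBot ℕ∞) ≤ ringKrullDim (MvPolynomial (Fin n) k ⧸ jacIdeal f)) :
    ∃ (K : Type) (_ : Field K) (_ : IsAlgClosed K) (_ : Algebra k K) (l : Fin s → K) (i₀ : Fin s)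
      (r : ℕ), l i₀ = 1 ∧ a ≤ r + (s - 1) ∧
      (r : WithBot ℕ∞) ≤ ringKrullDim (MvPolynomial (Fin n) K ⧸ Ideal.span
        (Set.range fun j ↦ ∑ i, C (l i) * pderiv j (map (algebraMap k K) (f i)))) := by
  obtain ⟨Q, hQ, hJQ, haQ⟩ := Ideal.exists_isPrime_le_ringKrullDim_quotient ha
  obtain ⟨F, _, _, _, z, m, hzQ, halg, h1, h2⟩ := exists_isAlgClosed_point_trdeg_eq Q
  have ham : a ≤ m := by
    rw [h1] at haQ
    exact_mod_cast haQ
  obtain ⟨l, hl0, hl⟩ := exists_vecMul_eq_zero_of_det_submatrix_eq_zero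
    (Matrix.of fun i j ↦ aeval z (pderiv j (f i))) fun c ↦ by
      have := hzQ _ (hJQ (Ideal.subset_span ⟨c, rfl⟩))
      rw [AlgHom.map_det] at this
      rw [← this]
      rfl
  obtain ⟨i₀, hi₀⟩ := Function.ne_iff.mp hl0
  obtain ⟨K, hK, hSK, htr⟩ := exists_isAlgClosed_trdeg_le (k := k)
    ((fun i ↦ (l i₀)⁻¹ * l i) '' {i | i ≠ i₀})
  have hmem : ∀ i, (l i₀)⁻¹ * l i ∈ K := fun i ↦ by
    rcases eq_or_ne i i₀ with rfl | hi
    · rw [inv_mul_cancel₀ hi₀]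
      exact K.one_mem
    · exact hSK ⟨i, hi, rfl⟩
  have htrK : Algebra.trdeg k K ≤ (s - 1 : ℕ) := by
    refine htr.trans (Cardinal.mk_image_le.trans ?_)
    rw [Cardinal.mk_fintype, Nat.cast_le]
    simp [Finset.filter_ne']
  have hadd := trdeg_add_eq k K (A := F)
  rw [h2] at hadd
  obtain ⟨r, hr⟩ := Cardinal.lt_aleph0.mp ((le_add_self.trans hadd.le).trans_lt
    (Cardinal.natCast_lt_aleph0 (n := m)))
  refine ⟨K, inferInstance, hK, inferInstance, fun i ↦ ⟨_, hmem i⟩, i₀, r,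
    Subtype.ext (inv_mul_cancel₀ hi₀), ?_, ?_⟩
  · have : (m : Cardinal) ≤ ((s - 1 : ℕ) : Cardinal) + r := by
      rw [← hadd, ← hr]
      gcongr
    have : m ≤ s - 1 + r := by exact_mod_cast this
    omega
  · have := isAlgebraic_adjoin_of_isScalarTower k K (Set.range z)
    obtain ⟨ι, u, hu, hι⟩ := exists_algebraicIndependent_comp (k := K) z
    have hr' : Nat.card ι = r := by
      rw [Nat.card, hι, hr, Cardinal.toNat_natCast]
    rw [← hr']
    refine natCard_le_ringKrullDim_quotient _ z (fun p hp ↦ ?_) u hu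
    rw [← RingHom.mem_ker]
    refine (Ideal.span_le.mpr ?_) hp
    rintro _ ⟨j, rfl⟩
    have := congrFun hl j
    simp only [Matrix.vecMul, dotProduct, Matrix.of_apply, Pi.zero_apply] at this
    simp only [SetLike.mem_coe, RingHom.mem_ker, map_sum, map_mul, pderiv_map,
      aeval_map_algebraMap, algHom_C, IntermediateField.algebraMap_apply, mul_assoc]
    rw [← Finset.mul_sum, this, mul_zero]

theorem le_ringKrullDim_quotient_zSymFamIdeal {k K : Type} [Field k] [Field K] [IsAlgClosed K]
    [Algebra k K] {n d s : ℕ} {ι : Type*} [Fintype ι] {f : Fin s → MvPolynomial (Fin n) k}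
    (hf : ∀ i, (f i).IsHomogeneous d) {l : Fin s → K} {i₀ : Fin s} (hl : l i₀ = 1) {w t : ι → K}
    (hw : ∀ e < d, ∑ i, w i * t i ^ e = if e = 1 then 1 else 0) {r : ℕ}
    (hr : (r : WithBot ℕ∞) ≤ ringKrullDim (MvPolynomial (Fin n) K ⧸ Ideal.span
        (Set.range fun j ↦ ∑ i, C (l i) * pderiv j (map (algebraMap k K) (f i))))) :
    ((n + n + Fintype.card ι * r - Fintype.card ι * n : ℕ) : WithBot ℕ∞) ≤
      ringKrullDim (MvPolynomial (Fin n ⊕ Fin n) k ⧸ zSymFamIdeal f) := by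
  obtain ⟨p, hp, hrp⟩ := exists_le_ker_and_le_height hr
  have hh := natCard_le_height_ker_aeval (Sum.elim 0 p : Fin n ⊕ Fin n → K)
  obtain ⟨h1, h2⟩ := le_height_map_mk_iSup (aeval (Sum.elim 0 p)) p
    (fun i ↦ (aeval fun j ↦ X (Sum.inr j) + C (t i) * X (Sum.inl j) :
      MvPolynomial (Fin n) K →ₐ[K] MvPolynomial (Fin n ⊕ Fin n) K))
    (fun i ↦ by ext j; simp) hp hrp hh Finset.univ
  have hZ := zSymFamIdeal_le (f := fun i ↦ map (algebraMap k K) (f i)) (fun i ↦ (hf i).map _) hl hw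
  refine le_ringKrullDim_quotient_of_map_mem
    (fun q hq ↦ hZ (map_mem_zSymFamIdeal (algebraMap k K) f hq)) ?_
  have hprime := RingHom.ker_isPrime
    (aeval (Sum.elim 0 p) : MvPolynomial (Fin n ⊕ Fin n) K →ₐ[K] K)
  have := Ideal.isPrime_map_quotientMk_of_isPrime h1
  have hcast (x : ℕ∞) (hx : (Nat.card (Fin n ⊕ Fin n) : ℕ∞) + (Finset.univ : Finset ι).card * r ≤
      x + (Finset.univ : Finset ι).card * n) :
      ((n + n + Fintype.card ι * r - Fintype.card ι * n : ℕ) : WithBot ℕ∞) ≤ x := by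
    refine WithBot.coe_le_coe.mpr (le_of_eq_of_le (ENat.natCast_sub _ _) ?_)
    rw [tsub_le_iff_right]
    simpa using hx
  exact (hcast _ h2).trans (Ideal.height_le_ringKrullDim_of_ne_top this.ne_top)

theorem affineCodim_le {σ : Type} [Fintype σ] {k : Type} [Field k] {I : Ideal (MvPolynomial σ k)}
    {a : ℕ} (ha : (a : WithBot ℕ∞) ≤ ringKrullDim (MvPolynomial σ k ⧸ I)) :
    affineCodim k I ≤ (Fintype.card σ - a : ℕ) := by
  unfold affineCodim affineDim
  generalize ringKrullDim (MvPolynomial σ k ⧸ I) = x at ha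
  induction x using WithBot.recBotCoe with
  | bot => exact absurd ha (by simp)
  | coe x =>
    rw [WithBot.recBotCoe_coe, ENat.natCast_sub]
    exact tsub_le_tsub_left (by exact_mod_cast ha) _

theorem affineCodim_eq_top_or {σ : Type} [Fintype σ] {k : Type} [Field k]
    (I : Ideal (MvPolynomial σ k)) :
    affineCodim k I = ⊤ ∨ ∃ a : ℕ, (a : WithBot ℕ∞) ≤ ringKrullDim (MvPolynomial σ k ⧸ I) ∧
      affineCodim k I = (Fintype.card σ - a : ℕ) := by
  unfold affineCodim affineDim
  generalize ringKrullDim (MvPolynomial σ k ⧸ I) = x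
  induction x using WithBot.recBotCoe with
  | bot => exact Or.inl rfl
  | coe x =>
    refine Or.inr ?_
    induction x using ENat.recTopCoe with
    | top => exact ⟨Fintype.card σ, WithBot.coe_le_coe.mpr le_top, by
      rw [WithBot.recBotCoe_coe, Nat.sub_self, Nat.cast_zero, tsub_eq_zero_of_le le_top]⟩
    | coe x => exact ⟨x, le_rfl, (ENat.natCast_sub _ _).symm⟩

theorem affineCodim_zSymFamIdeal_le {k : Type} [Field k] {n d s : ℕ} (ι : Type*) [Fintype ι]
    {f : Fin s → MvPolynomial (Fin n) k} (hf : ∀ i, (f i).IsHomogeneous d)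
    (hw : ∀ (K : Type) [Field K] [IsAlgClosed K] [Algebra k K],
      ∃ w t : ι → K, ∀ e < d, ∑ i, w i * t i ^ e = if e = 1 then 1 else 0)
    {a : ℕ} (ha : (a : WithBot ℕ∞) ≤ ringKrullDim (MvPolynomial (Fin n) k ⧸ jacIdeal f)) :
    affineCodim k (zSymFamIdeal f) ≤ (Fintype.card ι * (n - a + (s - 1)) : ℕ) := by
  obtain ⟨K, _, _, _, l, i₀, r, hl, har, hr⟩ := exists_isAlgClosed_le_ringKrullDim_quotient f ha
  obtain ⟨w, t, hwt⟩ := hw K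
  refine (affineCodim_le (le_ringKrullDim_quotient_zSymFamIdeal hf hl hwt hr)).trans ?_
  rw [Nat.cast_le, Fintype.card_sum, Fintype.card_fin]
  have h1 : Fintype.card ι * n ≤ Fintype.card ι * (r + (n - a + (s - 1))) :=
    Nat.mul_le_mul_left _ (by omega)
  rw [mul_add] at h1
  omega

/-- Proposition 3.3(ii). For a collection `f̄ = (f 1, …, f s)` of
homogeneous polynomials of degree `d` on `V`, not all zero, one has
`g_sym(f̄) ≤ (d+1) · c'(f̄) + d·(s-1)`, and `g_sym(f̄) ≤ d · c'(f̄) + (d-1)·(s-1)` when `d`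
is odd and `char k ≠ 2`.  Here `g_sym(f̄)` is the codimension of `Z^sym_{f̄}` in `V × V` and
`c'(f̄)` the codimension in `V` of the locus `S(f̄)` where the Jacobian of `f̄` has
rank `< s`. -/
theorem gsymFam_le_mul_c' {k : Type} [Field k] {n d s : ℕ}
    (f : Fin s → MvPolynomial (Fin n) k) (hf : f ≠ 0) (hhom : ∀ i, (f i).IsHomogeneous d) :
    affineCodim k (zSymFamIdeal f) ≤
        ((d + 1 : ℕ) : ℕ∞) * affineCodim k (jacIdeal f) + ((d * (s - 1) : ℕ) : ℕ∞) ∧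
      (Odd d → (2 : k) ≠ 0 →
        affineCodim k (zSymFamIdeal f) ≤
          ((d : ℕ) : ℕ∞) * affineCodim k (jacIdeal f) + (((d - 1) * (s - 1) : ℕ) : ℕ∞)) := by
  constructor
  · obtain h | ⟨a, ha, h⟩ := affineCodim_eq_top_or (jacIdeal f)
    · rw [h, ENat.mul_top (by simp), top_add]
      exact le_top
    · refine (affineCodim_zSymFamIdeal_le (Fin d) hhom (fun K _ _ _ ↦ ?_) ha).trans ?_
      · have : Infinite K := IsAlgClosed.instInfinite
        exact exists_weights K d
      · rw [h, Fintype.card_fin, Fintype.card_fin, mul_add]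
        norm_cast
        gcongr
        exact d.le_succ
  · rintro ⟨r, rfl⟩ h2
    obtain h | ⟨a, ha, h⟩ := affineCodim_eq_top_or (jacIdeal f)
    · rw [h, ENat.mul_top (by simp), top_add]
      exact le_top
    · refine (affineCodim_zSymFamIdeal_le (Fin r ⊕ Fin r) hhom (fun K _ _ _ ↦ ?_) ha).trans ?_
      · refine exists_symmetric_weights K (fun h ↦ h2 ?_) r
        exact (algebraMap k K).injective (by rw [map_ofNat, map_zero, h])
      · rw [h, Fintype.card_sum, Fintype.card_fin, Fintype.card_fin, mul_add, ← two_mul,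
          Nat.add_sub_cancel]
        norm_cast
        gcongr
        exact Nat.le_succ _
end
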